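/- arXiv:2603.24951 — 3 statements merged into one kernel-verified Lean document; each statement's English description precedes it below -/
import Mathlib

section
/- Let φ : ℝⁿ → ℝ ∪ {+∞} be proper, lower semicontinuous and ρ-weakly convex for some ρ ≥ 0. If d²φ(x,v)(w) ≥ 0 for every w ∈ ℝⁿ and every (x,v) ∈ gph ∂φ at which φ is generalized twice differentiable, then φ is convex. -/
open scoped RealInnerProductSpace
open Filter Topology MeasureTheory Set

noncomputable section

variable {n : ℕ}

/-- Convexity of an extended-real-valued function `φ : ℝⁿ → ℝ ∪ {+∞}`. -/
def ERealConvex {F : Type*} [AddCommGroup F] [Module ℝ F] (φ : F → EReal) : Prop :=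
  ∀ x y : F, ∀ a b : ℝ, 0 ≤ a → 0 ≤ b → a + b = 1 →
    φ (a • x + b • y) ≤ (a : EReal) * φ x + (b : EReal) * φ y

/-- The shifted function `x ↦ φ(x) + (ρ/2)‖x‖²`. -/
def shiftFun (ρ : ℝ) (φ : EuclideanSpace ℝ (Fin n) → EReal) :
    EuclideanSpace ℝ (Fin n) → EReal :=
  fun x => φ x + (((ρ / 2) * ‖x‖ ^ 2 : ℝ) : EReal)

/-- The subdifferential of a `ρ`-weakly convex function. -/
def subdiff (ρ : ℝ) (φ : EuclideanSpace ℝ (Fin n) → EReal)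
    (x : EuclideanSpace ℝ (Fin n)) : Set (EuclideanSpace ℝ (Fin n)) :=
  {v | φ x ≠ ⊤ ∧
    ∀ u, φ x + ((⟪v, u - x⟫ - (ρ / 2) * ‖u - x‖ ^ 2 : ℝ) : EReal) ≤ φ u}

/-- Graph of the subdifferential mapping. -/
def gphSubdiff (ρ : ℝ) (φ : EuclideanSpace ℝ (Fin n) → EReal) :
    Set (EuclideanSpace ℝ (Fin n) × EuclideanSpace ℝ (Fin n)) :=
  {p | p.2 ∈ subdiff ρ φ p.1}

/-- The (Bouligand–Severi) tangent/contingent cone to `S` at `z`. -/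
def contTangentCone {F : Type*} [NormedAddCommGroup F] [NormedSpace ℝ F]
    (S : Set F) (z : F) : Set F :=
  {w | ∃ (t : ℕ → ℝ) (ws : ℕ → F), (∀ k, 0 < t k) ∧ Tendsto t atTop (𝓝 0) ∧
    Tendsto ws atTop (𝓝 w) ∧ ∀ k, z + t k • ws k ∈ S}

/-- Inner product of pairs in `ℝⁿ × ℝⁿ`. -/
def pairInner (p q : EuclideanSpace ℝ (Fin n) × EuclideanSpace ℝ (Fin n)) : ℝ :=
  ⟪p.1, q.1⟫ + ⟪p.2, q.2⟫

/-- The (Fréchet) regular normal cone to `S` at `z`. -/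
def regNormalCone (S : Set (EuclideanSpace ℝ (Fin n) × EuclideanSpace ℝ (Fin n)))
    (z : EuclideanSpace ℝ (Fin n) × EuclideanSpace ℝ (Fin n)) :
    Set (EuclideanSpace ℝ (Fin n) × EuclideanSpace ℝ (Fin n)) :=
  {v | ∀ ε > (0 : ℝ), ∃ δ > (0 : ℝ), ∀ u ∈ S, ‖u - z‖ < δ →
      pairInner v (u - z) ≤ ε * ‖u - z‖}

/-- The (Mordukhovich) limiting normal cone to `S` at `z`. -/
def limNormalCone (S : Set (EuclideanSpace ℝ (Fin n) × EuclideanSpace ℝ (Fin n)))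
    (z : EuclideanSpace ℝ (Fin n) × EuclideanSpace ℝ (Fin n)) :
    Set (EuclideanSpace ℝ (Fin n) × EuclideanSpace ℝ (Fin n)) :=
  {v | ∃ zs vs : ℕ → EuclideanSpace ℝ (Fin n) × EuclideanSpace ℝ (Fin n),
    (∀ k, zs k ∈ S) ∧ Tendsto zs atTop (𝓝 z) ∧ Tendsto vs atTop (𝓝 v) ∧
    ∀ k, vs k ∈ regNormalCone S (zs k)}

/-- The Moreau envelope `e_λ φ`. -/
def moreau (lam : ℝ) (φ : EuclideanSpace ℝ (Fin n) → EReal)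
    (x : EuclideanSpace ℝ (Fin n)) : EReal :=
  ⨅ y, (φ y + ((‖y - x‖ ^ 2 / (2 * lam) : ℝ) : EReal))

/-- Second-order difference quotient `Δ²_τ φ(x,v)(u)`. -/
def delta2 (φ : EuclideanSpace ℝ (Fin n) → EReal) (x v : EuclideanSpace ℝ (Fin n))
    (τ : ℝ) (u : EuclideanSpace ℝ (Fin n)) : EReal :=
  ((2 / τ ^ 2 : ℝ) : EReal) * (φ (x + τ • u) - φ x - ((τ * ⟪v, u⟫ : ℝ) : EReal))

/-- The second subderivative `d²φ(x,v)(w)`. -/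
def secondSubderiv (φ : EuclideanSpace ℝ (Fin n) → EReal)
    (x v w : EuclideanSpace ℝ (Fin n)) : EReal :=
  Filter.liminf (fun p : ℝ × EuclideanSpace ℝ (Fin n) => delta2 φ x v p.1 p.2)
    ((𝓝[>] (0 : ℝ)) ×ˢ 𝓝 w)

/-- Twice epi-differentiability of `φ` at `x` for `v`. -/
def TwiceEpiDiff (φ : EuclideanSpace ℝ (Fin n) → EReal)
    (x v : EuclideanSpace ℝ (Fin n)) : Prop :=
  ∀ w : EuclideanSpace ℝ (Fin n), ∀ τ : ℕ → ℝ, (∀ k, 0 < τ k) →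
    Tendsto τ atTop (𝓝 0) →
    ∃ ws : ℕ → EuclideanSpace ℝ (Fin n), Tendsto ws atTop (𝓝 w) ∧
      Tendsto (fun k => delta2 φ x v (τ k) (ws k)) atTop (𝓝 (secondSubderiv φ x v w))

/-- Generalized twice differentiability of `φ` at `x` for `v`. -/
def GenTwiceDiff (φ : EuclideanSpace ℝ (Fin n) → EReal)
    (x v : EuclideanSpace ℝ (Fin n)) : Prop :=
  TwiceEpiDiff φ x v ∧
    ∃ (A : EuclideanSpace ℝ (Fin n) →ₗ[ℝ] EuclideanSpace ℝ (Fin n))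
      (L : Submodule ℝ (EuclideanSpace ℝ (Fin n))),
      (∀ u w, ⟪A u, w⟫ = ⟪u, A w⟫) ∧
      (∀ w ∈ L, secondSubderiv φ x v w = ((⟪w, A w⟫ : ℝ) : EReal)) ∧
      (∀ w ∉ L, secondSubderiv φ x v w = (⊤ : EReal))


section Helpers


lemma mono_of_ae_fderiv {K : NNReal} {g : (EuclideanSpace ℝ (Fin n)) → ℝ} (hg : LipschitzWith K g) (h : (EuclideanSpace ℝ (Fin n)))
    (hae : ∀ᵐ z : (EuclideanSpace ℝ (Fin n)), 0 ≤ fderiv ℝ g z h) (z0 : (EuclideanSpace ℝ (Fin n))) : g z0 ≤ g (z0 + h) := by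
  by_contra hlt
  push Not at hlt
  obtain ⟨δ, hδ, hδ'⟩ : ∃ δ > 0, g (z0 + h) + δ < g z0 :=
    ⟨(g z0 - g (z0 + h)) / 2, by linarith, by linarith⟩
  have hcont := hg.continuous
  have hev : ∀ᶠ z in 𝓝 z0, g (z + h) + δ < g z := by
    have h1 : Continuous fun z => g (z + h) + δ := by fun_prop
    exact h1.continuousAt.eventually_lt hcont.continuousAt hδ'
  obtain ⟨r, hr, hball⟩ := Metric.eventually_nhds_iff_ball.1 hev
  set μ : Measure (EuclideanSpace ℝ (Fin n)) := volume.restrict (Metric.ball z0 r) with hμ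
  have hfin : IsFiniteMeasure μ := ⟨by
    rw [hμ, Measure.restrict_apply_univ]; exact measure_ball_lt_top⟩
  have hint : ∀ k : (EuclideanSpace ℝ (Fin n)), Integrable (fun z => g (z + k)) μ := by
    intro k
    have h1 : Continuous fun z => g (z + k) := by fun_prop
    have h2 := h1.continuousOn.integrableOn_compact (μ := volume) (isCompact_closedBall z0 r)
    exact h2.mono_set Metric.ball_subset_closedBall
  have hder : ∀ t0 : ℝ, HasDerivAt (fun t : ℝ => ∫ a, g (a + t • h) ∂μ)
      (∫ a, lineDeriv ℝ g (a + t0 • h) h ∂μ) t0 := by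
    intro t0
    refine (hasDerivAt_integral_of_dominated_loc_of_lip (s := univ)
      (bound := fun _ => (K : ℝ) * ‖h‖) (F := fun (t : ℝ) a => g (a + t • h)) (μ := μ)
      Filter.univ_mem ?_ (hint _) ?_ ?_ (integrable_const _) ?_).2
    · exact Eventually.of_forall fun t => (hint _).aestronglyMeasurable
    · have := measurable_lineDeriv (𝕜 := ℝ) (v := h) hcont
      exact (this.comp (measurable_add_const _)).aestronglyMeasurable
    · refine Eventually.of_forall fun a => ?_
      refine LipschitzOnWith.of_dist_le_mul fun s _ t _ => ?_
      refine (hg.dist_le_mul _ _).trans ?_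
      rw [dist_add_left, dist_eq_norm, ← sub_smul, norm_smul, dist_eq_norm]
      simp only [Real.coe_nnabs]
      rw [abs_of_nonneg (by positivity)]
      nlinarith
    · have h1 : ∀ᵐ a : (EuclideanSpace ℝ (Fin n)), DifferentiableAt ℝ g (a + t0 • h) :=
        (measurePreserving_add_right volume (t0 • h)).quasiMeasurePreserving.ae
          hg.ae_differentiableAt
      filter_upwards [ae_restrict_of_ae h1] with a ha
      have h2 : HasDerivAt (fun t : ℝ => a + t • h) h t0 := by
        simpa using ((hasDerivAt_id t0).smul_const h).const_add a
      have h3 := ha.hasFDerivAt.comp_hasDerivAt t0 h2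
      rw [ha.lineDeriv_eq_fderiv]
      exact h3
  have hnn : ∀ t0 : ℝ, 0 ≤ ∫ a, lineDeriv ℝ g (a + t0 • h) h ∂μ := by
    intro t0
    apply integral_nonneg_of_ae
    have h1 : ∀ᵐ a : (EuclideanSpace ℝ (Fin n)), DifferentiableAt ℝ g (a + t0 • h) ∧ 0 ≤ fderiv ℝ g (a + t0 • h) h :=
      (measurePreserving_add_right volume (t0 • h)).quasiMeasurePreserving.ae
        (hg.ae_differentiableAt.and hae)
    filter_upwards [ae_restrict_of_ae h1] with a ha
    simp only [Pi.zero_apply]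
    rw [ha.1.lineDeriv_eq_fderiv]
    exact ha.2
  have hmono : Monotone (fun t : ℝ => ∫ a, g (a + t • h) ∂μ) :=
    monotone_of_deriv_nonneg (fun t => (hder t).differentiableAt)
      (fun t => by rw [(hder t).deriv]; exact hnn t)
  have h01 := hmono (zero_le_one)
  simp only [zero_smul, add_zero, one_smul] at h01
  have h2 : ∫ a, (g (a + h) + δ) ∂μ ≤ ∫ a, g a ∂μ := by
    refine setIntegral_mono_on (μ := volume) ((hint h).add (integrable_const _)) ?_ measurableSet_ball ?_
    · have h4 := hint 0
      simp only [add_zero] at h4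
      exact h4
    · intro x hx; exact (hball x hx).le
  rw [integral_add (hint h) (integrable_const _), integral_const] at h2
  have h3 : 0 < μ.real univ := by
    rw [hμ, Measure.real, Measure.restrict_apply_univ]
    exact ENNReal.toReal_pos (Metric.measure_ball_pos _ _ hr).ne' measure_ball_lt_top.ne
  have : 0 < μ.real univ • δ := by simpa using mul_pos h3 hδ
  linarith

/-- real-valued form of weak convexity -/
def WC (ρ : ℝ) (φ : (EuclideanSpace ℝ (Fin n)) → EReal) : Prop :=
  ∀ x y : (EuclideanSpace ℝ (Fin n)), φ x ≠ ⊤ → φ y ≠ ⊤ → ∀ a b : ℝ, 0 ≤ a → 0 ≤ b → a + b = 1 →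
    φ (a • x + b • y) ≠ ⊤ ∧
    (φ (a • x + b • y)).toReal ≤ a * (φ x).toReal + b * (φ y).toReal
      + ρ / 2 * (a * b) * ‖x - y‖ ^ 2

lemma norm_combo (x y : (EuclideanSpace ℝ (Fin n))) (a b : ℝ) (hab : a + b = 1) :
    ‖a • x + b • y‖ ^ 2 = a * ‖x‖ ^ 2 + b * ‖y‖ ^ 2 - a * b * ‖x - y‖ ^ 2 := by
  rw [norm_add_sq_real, norm_sub_sq_real, norm_smul, norm_smul, inner_smul_left, inner_smul_right]
  simp only [mul_pow, Real.norm_eq_abs, sq_abs, conj_trivial]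
  obtain rfl : b = 1 - a := by linarith
  ring

lemma wc_of_weak {ρ : ℝ} {φ : (EuclideanSpace ℝ (Fin n)) → EReal} (hnotbot : ∀ x, φ x ≠ ⊥)
    (hweak : ERealConvex (shiftFun ρ φ)) : WC ρ φ := by
  intro x y hx hy a b ha hb hab
  have h := hweak x y a b ha hb hab
  simp only [shiftFun] at h
  have hn := norm_combo x y a b hab
  generalize a • x + b • y = p at *
  have hp' := hnotbot p
  lift φ x to ℝ using ⟨hx, hnotbot x⟩ with fx
  lift φ y to ℝ using ⟨hy, hnotbot y⟩ with fy
  have hp : φ p ≠ ⊤ := by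
    intro hp
    rw [hp, EReal.top_add_coe, top_le_iff] at h
    norm_cast at h
    exact EReal.coe_ne_top _ h
  refine ⟨hp, ?_⟩
  lift φ p to ℝ using ⟨hp, hp'⟩ with fp
  norm_cast at h
  rw [hn] at h
  simp only [EReal.toReal_coe]
  nlinarith

lemma exists_min {ρ c : ℝ} {φ : (EuclideanSpace ℝ (Fin n)) → EReal} (hnotbot : ∀ x, φ x ≠ ⊥) (hproper : ∃ x, φ x ≠ ⊤)
    (hlsc : LowerSemicontinuous φ) (hρ : 0 ≤ ρ) (hW : WC ρ φ) (hc : ρ < c) (z : (EuclideanSpace ℝ (Fin n))) :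
    ∃ y, φ y ≠ ⊤ ∧ ∀ u, φ u ≠ ⊤ →
      (φ y).toReal + c / 2 * ‖y - z‖ ^ 2 ≤ (φ u).toReal + c / 2 * ‖u - z‖ ^ 2 := by
  obtain ⟨x0, hx0⟩ := hproper
  -- lower bound on the unit ball
  obtain ⟨y1, hy1, hmin1⟩ := (hlsc.lowerSemicontinuousOn (Metric.closedBall x0 1)).exists_isMinOn
    ⟨x0, by simp⟩ (isCompact_closedBall x0 1)
  have hmin1' := isMinOn_iff.1 hmin1
  have hy1t : φ y1 ≠ ⊤ := fun h => hx0 (top_le_iff.1 (h ▸ hmin1' x0 (by simp)))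
  set m := (φ y1).toReal with hm
  have hm1 : ∀ u ∈ Metric.closedBall x0 1, φ u ≠ ⊤ → m ≤ (φ u).toReal := fun u hu hut =>
    EReal.toReal_le_toReal (hmin1' u hu) (hnotbot _) hut
  set f0 := (φ x0).toReal with hf0
  set d := ‖x0 - z‖ with hd
  set R := max 1 (2 * (f0 - m - ρ / 2 + c * d) / (c - ρ)) with hR
  have hR1 : 1 ≤ R := le_max_left _ _
  have hfar : ∀ u, φ u ≠ ⊤ → R < ‖u - x0‖ →
      f0 + c / 2 * d ^ 2 ≤ (φ u).toReal + c / 2 * ‖u - z‖ ^ 2 := by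
    intro u hu hur
    set r := ‖u - x0‖ with hr
    have hr1 : 1 < r := hR1.trans_lt hur
    have hr2 : 2 * (f0 - m - ρ / 2 + c * d) < (c - ρ) * r := by
      have h1 : 2 * (f0 - m - ρ / 2 + c * d) / (c - ρ) < r := (le_max_right _ _).trans_lt hur
      rw [div_lt_iff₀ (by linarith)] at h1
      linarith
    have hrinv : r * r⁻¹ = 1 := mul_inv_cancel₀ (by positivity)
    have hrinv1 : r⁻¹ ≤ 1 := inv_le_one_of_one_le₀ hr1.le
    obtain ⟨h1, h2⟩ := hW x0 u hx0 hu (1 - r⁻¹) r⁻¹ (by linarith) (by positivity) (by ring)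
    have h3 : (1 - r⁻¹) • x0 + r⁻¹ • u ∈ Metric.closedBall x0 1 := by
      rw [mem_closedBall_iff_norm]
      have : (1 - r⁻¹) • x0 + r⁻¹ • u - x0 = r⁻¹ • (u - x0) := by module
      rw [this, norm_smul, ← hr, norm_inv, Real.norm_eq_abs, abs_of_pos (by linarith), mul_comm, hrinv]
    have h4 := (hm1 _ h3 h1).trans h2
    rw [norm_sub_rev, ← hr] at h4
    have h5 : r * m ≤ (r - 1) * f0 + (φ u).toReal + ρ / 2 * (r - 1) * r := by
      have := mul_le_mul_of_nonneg_left h4 (by linarith : 0 ≤ r)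
      calc r * m ≤ _ := this
        _ = (r - r * r⁻¹) * f0 + (r * r⁻¹) * (φ u).toReal
            + ρ / 2 * (r - r * r⁻¹) * (r * r⁻¹) * r := by ring
        _ = _ := by rw [hrinv]; ring
    have h6 : r - d ≤ ‖u - z‖ := by
      have := norm_add_le (u - z) (z - x0)
      rw [sub_add_sub_cancel, norm_sub_rev z x0] at this
      linarith
    have h7 : r ^ 2 - 2 * r * d + d ^ 2 ≤ ‖u - z‖ ^ 2 := by
      have h8 : d - r ≤ ‖u - z‖ := by
        have := norm_add_le (x0 - u) (u - z)
        rw [sub_add_sub_cancel, norm_sub_rev x0 u] at this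
        linarith
      have := sq_le_sq' (by linarith : -‖u - z‖ ≤ r - d)
        (show r - d ≤ ‖u - z‖ from h6)
      nlinarith
    have h9 := mul_le_mul_of_nonneg_left h7 (by linarith : 0 ≤ c / 2)
    have h10 := mul_le_mul_of_nonneg_right hr2.le (by linarith : 0 ≤ r)
    nlinarith
  -- minimise on a compact ball
  have hl2 : LowerSemicontinuous fun u => φ u + ((c / 2 * ‖u - z‖ ^ 2 : ℝ) : EReal) := by
    refine hlsc.add' ?_ ?_
    · have : Continuous fun u : (EuclideanSpace ℝ (Fin n)) => ((c / 2 * ‖u - z‖ ^ 2 : ℝ) : EReal) :=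
        continuous_coe_real_ereal.comp (by fun_prop)
      exact this.lowerSemicontinuous
    · intro x
      exact EReal.continuousAt_add (Or.inr (EReal.coe_ne_bot _)) (Or.inr (EReal.coe_ne_top _))
  obtain ⟨y, hy, hmin⟩ := (hl2.lowerSemicontinuousOn (Metric.closedBall x0 R)).exists_isMinOn
    ⟨x0, by simp; linarith⟩ (isCompact_closedBall x0 R)
  have hmin' := isMinOn_iff.1 hmin
  have hx0m := hmin' x0 (by simp; linarith)
  have hyt : φ y ≠ ⊤ := by
    intro h
    rw [h, EReal.top_add_coe, top_le_iff] at hx0m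
    lift φ x0 to ℝ using ⟨hx0, hnotbot x0⟩ with fx
    norm_cast at hx0m
    exact EReal.coe_ne_top _ hx0m
  have hreal : ∀ u, φ u ≠ ⊤ → u ∈ Metric.closedBall x0 R →
      (φ y).toReal + c / 2 * ‖y - z‖ ^ 2 ≤ (φ u).toReal + c / 2 * ‖u - z‖ ^ 2 := by
    intro u hu hub
    have := hmin' u hub
    lift φ u to ℝ using ⟨hu, hnotbot u⟩ with fu
    lift φ y to ℝ using ⟨hyt, hnotbot y⟩ with fy
    norm_cast at this
  refine ⟨y, hyt, fun u hu => ?_⟩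
  by_cases hub : u ∈ Metric.closedBall x0 R
  · exact hreal u hu hub
  · rw [mem_closedBall_iff_norm, not_le] at hub
    exact (hreal x0 hx0 (by simp; linarith)).trans (hfar u hu hub)

lemma subgrad_of_min {ρ c : ℝ} {φ : (EuclideanSpace ℝ (Fin n)) → EReal} (hW : WC ρ φ) {z y : (EuclideanSpace ℝ (Fin n))} (hy : φ y ≠ ⊤)
    (hmin : ∀ u, φ u ≠ ⊤ →
      (φ y).toReal + c / 2 * ‖y - z‖ ^ 2 ≤ (φ u).toReal + c / 2 * ‖u - z‖ ^ 2)
    (u : (EuclideanSpace ℝ (Fin n))) (hu : φ u ≠ ⊤) :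
    (φ y).toReal + c * ⟪z - y, u - y⟫ - ρ / 2 * ‖u - y‖ ^ 2 ≤ (φ u).toReal := by
  have key : ∀ t : ℝ, t ∈ Ioo (0:ℝ) 1 →
      0 ≤ (φ u).toReal - (φ y).toReal + ρ / 2 * (1 - t) * ‖u - y‖ ^ 2 - c * ⟪z - y, u - y⟫
        + c / 2 * t * ‖u - y‖ ^ 2 := by
    intro t ht
    obtain ⟨h1, h2⟩ := hW y u hy hu (1 - t) t (by linarith [ht.2]) ht.1.le (by ring)
    have h3 := (hmin _ h1).trans (add_le_add_left h2 _)
    have h4 : (1 - t) • y + t • u - z = (y - z) + t • (u - y) := by module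
    rw [h4, norm_add_sq_real, norm_smul, inner_smul_right, mul_pow, Real.norm_eq_abs, sq_abs,
      norm_sub_rev y u] at h3
    have h5 : ⟪y - z, u - y⟫ = - ⟪z - y, u - y⟫ := by rw [← inner_neg_left, neg_sub]
    rw [h5] at h3
    have h6 : 0 ≤ t * ((φ u).toReal - (φ y).toReal + ρ / 2 * (1 - t) * ‖u - y‖ ^ 2
        - c * ⟪z - y, u - y⟫ + c / 2 * t * ‖u - y‖ ^ 2) := by linarith
    exact nonneg_of_mul_nonneg_right h6 ht.1
  have hlim : Tendsto (fun t : ℝ => (φ u).toReal - (φ y).toReal + ρ / 2 * (1 - t) * ‖u - y‖ ^ 2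
      - c * ⟪z - y, u - y⟫ + c / 2 * t * ‖u - y‖ ^ 2) (𝓝[>] 0)
      (𝓝 ((φ u).toReal - (φ y).toReal + ρ / 2 * (1 - 0) * ‖u - y‖ ^ 2
      - c * ⟪z - y, u - y⟫ + c / 2 * 0 * ‖u - y‖ ^ 2)) := by
    have : Continuous (fun t : ℝ => (φ u).toReal - (φ y).toReal + ρ / 2 * (1 - t) * ‖u - y‖ ^ 2
      - c * ⟪z - y, u - y⟫ + c / 2 * t * ‖u - y‖ ^ 2) := by fun_prop
    exact (this.tendsto 0).mono_left nhdsWithin_le_nhds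
  have := ge_of_tendsto hlim (by
    filter_upwards [Ioo_mem_nhdsGT (zero_lt_one' ℝ)] with t ht using key t ht)
  linarith

/-- `P` is a proximal map of `φ` with parameter `c`. -/
def IsProx (ρ c : ℝ) (φ : (EuclideanSpace ℝ (Fin n)) → EReal) (P : (EuclideanSpace ℝ (Fin n)) → (EuclideanSpace ℝ (Fin n))) : Prop :=
  ∀ z, φ (P z) ≠ ⊤ ∧ ∀ u, φ u ≠ ⊤ →
    (φ (P z)).toReal + c * ⟪z - P z, u - P z⟫ - ρ / 2 * ‖u - P z‖ ^ 2 ≤ (φ u).toReal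

lemma exists_prox {ρ c : ℝ} {φ : (EuclideanSpace ℝ (Fin n)) → EReal} (hnotbot : ∀ x, φ x ≠ ⊥) (hproper : ∃ x, φ x ≠ ⊤)
    (hlsc : LowerSemicontinuous φ) (hρ : 0 ≤ ρ) (hW : WC ρ φ) (hc : ρ < c) :
    ∃ P, IsProx ρ c φ P := by
  choose P hP using exists_min hnotbot hproper hlsc hρ hW hc
  exact ⟨P, fun z => ⟨(hP z).1, subgrad_of_min hW (hP z).1 (hP z).2⟩⟩

lemma prox_lip {ρ c : ℝ} {φ : (EuclideanSpace ℝ (Fin n)) → EReal} {P : (EuclideanSpace ℝ (Fin n)) → (EuclideanSpace ℝ (Fin n))} (hP : IsProx ρ c φ P) (hρ : 0 ≤ ρ)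
    (hc : ρ < c) : LipschitzWith (Real.toNNReal (c / (c - ρ))) P := by
  refine LipschitzWith.of_dist_le_mul fun z w => ?_
  rw [Real.coe_toNNReal _ (div_nonneg (by linarith) (by linarith)), dist_eq_norm, dist_eq_norm]
  have h1 := (hP z).2 (P w) (hP w).1
  have h2 := (hP w).2 (P z) (hP z).1
  rw [norm_sub_rev] at h1
  have h3 : ⟪z - P z, P w - P z⟫ + ⟪w - P w, P z - P w⟫ =
      ‖P z - P w‖ ^ 2 - ⟪z - w, P z - P w⟫ := by
    rw [← real_inner_self_eq_norm_sq]
    simp only [inner_sub_left, inner_sub_right]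
    ring
  have h4 := real_inner_le_norm (z - w) (P z - P w)
  have h5 : (c - ρ) * ‖P z - P w‖ ^ 2 ≤ c * (‖z - w‖ * ‖P z - P w‖) := by
    have := mul_le_mul_of_nonneg_left h4 (by linarith : 0 ≤ c)
    nlinarith
  rw [div_mul_eq_mul_div, le_div_iff₀ (by linarith)]
  rcases (norm_nonneg (P z - P w)).eq_or_lt with h0 | h0
  · rw [← h0]; have := norm_nonneg (z - w); nlinarith
  · nlinarith

/-- the envelope -/
def env (c : ℝ) (φ : (EuclideanSpace ℝ (Fin n)) → EReal) (P : (EuclideanSpace ℝ (Fin n)) → (EuclideanSpace ℝ (Fin n))) (z : (EuclideanSpace ℝ (Fin n))) : ℝ :=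
  (φ (P z)).toReal + c / 2 * ‖P z - z‖ ^ 2

lemma env_le {ρ c : ℝ} {φ : (EuclideanSpace ℝ (Fin n)) → EReal} {P : (EuclideanSpace ℝ (Fin n)) → (EuclideanSpace ℝ (Fin n))} (hP : IsProx ρ c φ P)
    (hc : ρ < c) (z u : (EuclideanSpace ℝ (Fin n))) (hu : φ u ≠ ⊤) :
    env c φ P z ≤ (φ u).toReal + c / 2 * ‖u - z‖ ^ 2 := by
  have h1 := (hP z).2 u hu
  have h2 : u - z = (P z - z) + (u - P z) := by abel
  have h5 : ⟪P z - z, u - P z⟫ = - ⟪z - P z, u - P z⟫ := by rw [← inner_neg_left, neg_sub]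
  rw [env, h2, norm_add_sq_real, h5]
  nlinarith [mul_nonneg (sub_nonneg.2 hc.le) (sq_nonneg ‖u - P z‖)]

lemma env_upper {ρ c : ℝ} {φ : (EuclideanSpace ℝ (Fin n)) → EReal} {P : (EuclideanSpace ℝ (Fin n)) → (EuclideanSpace ℝ (Fin n))} (hP : IsProx ρ c φ P)
    (hc : ρ < c) (z w : (EuclideanSpace ℝ (Fin n))) :
    env c φ P w ≤ env c φ P z + c * ⟪z - P z, w - z⟫ + c / 2 * ‖w - z‖ ^ 2 := by
  have h1 := env_le hP hc w (P z) (hP z).1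
  have h2 : P z - w = (P z - z) - (w - z) := by abel
  have h5 : ⟪P z - z, w - z⟫ = - ⟪z - P z, w - z⟫ := by rw [← inner_neg_left, neg_sub]
  rw [h2, norm_sub_sq_real, h5] at h1
  simp only [env] at *
  linarith

lemma env_hasFDeriv {ρ c : ℝ} {φ : (EuclideanSpace ℝ (Fin n)) → EReal} {P : (EuclideanSpace ℝ (Fin n)) → (EuclideanSpace ℝ (Fin n))} (hP : IsProx ρ c φ P) (hρ : 0 ≤ ρ)
    (hc : ρ < c) (z : (EuclideanSpace ℝ (Fin n))) :
    HasFDerivAt (env c φ P) (innerSL ℝ (c • (z - P z))) z := by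
  have hL := prox_lip hP hρ hc
  set K : ℝ := ((Real.toNNReal (c / (c - ρ)) : NNReal) : ℝ)
  have hK : 0 ≤ K := NNReal.coe_nonneg _
  refine HasFDerivAt.of_isLittleO ?_
  have hO : (fun w => env c φ P w - env c φ P z - (innerSL ℝ (c • (z - P z))) (w - z))
      =O[𝓝 z] fun w => ‖w - z‖ ^ 2 := by
    refine Asymptotics.IsBigO.of_bound (c / 2 + c * (1 + K)) (Eventually.of_forall fun w => ?_)
    rw [innerSL_apply_apply, inner_smul_left, norm_pow, norm_norm, Real.norm_eq_abs]
    simp only [conj_trivial]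
    have h1 := env_upper hP hc z w
    have h2 := env_upper hP hc w z
    have h3 : ⟪w - P w, z - w⟫ = - ⟪z - P z, w - z⟫ - ⟪(w - z) - (P w - P z), w - z⟫ := by
      simp only [inner_sub_left, inner_sub_right]; ring
    rw [h3, norm_sub_rev] at h2
    have h4 : |⟪(w - z) - (P w - P z), w - z⟫| ≤ (1 + K) * ‖w - z‖ ^ 2 := by
      refine (abs_real_inner_le_norm _ _).trans ?_
      have h6 : ‖(w - z) - (P w - P z)‖ ≤ (1 + K) * ‖w - z‖ := by
        refine (norm_sub_le _ _).trans ?_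
        have := hL.dist_le_mul w z
        rw [dist_eq_norm, dist_eq_norm] at this
        linarith
      nlinarith [mul_le_mul_of_nonneg_right h6 (norm_nonneg (w - z))]
    have h7 := abs_le.1 h4
    have hc0 : 0 ≤ c := by linarith
    have h8 := mul_le_mul_of_nonneg_left h7.1 hc0
    have h9 := mul_le_mul_of_nonneg_left h7.2 hc0
    have h10 : 0 ≤ c * ((1 + K) * ‖w - z‖ ^ 2) := by positivity
    rw [abs_le]
    constructor <;> nlinarith
  refine hO.trans_isLittleO ?_
  have := (Asymptotics.isLittleO_pow_sub_sub z (m := 2) (by norm_num : 1 < 2))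
  simpa using this

lemma prox_symm {ρ c : ℝ} {φ : (EuclideanSpace ℝ (Fin n)) → EReal} {P : (EuclideanSpace ℝ (Fin n)) → (EuclideanSpace ℝ (Fin n))} (hP : IsProx ρ c φ P) (hρ : 0 ≤ ρ)
    (hc : ρ < c) {z : (EuclideanSpace ℝ (Fin n))} {M : (EuclideanSpace ℝ (Fin n)) →L[ℝ] (EuclideanSpace ℝ (Fin n))} (hM : HasFDerivAt P M z) (a b : (EuclideanSpace ℝ (Fin n))) :
    ⟪M a, b⟫ = ⟪a, M b⟫ := by
  have h1 : HasFDerivAt (fun w => c • (w - P w)) (c • (ContinuousLinearMap.id ℝ (EuclideanSpace ℝ (Fin n)) - M)) z :=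
    ((hasFDerivAt_id z).sub hM).const_smul c
  have h2 : HasFDerivAt (fun w => innerSL ℝ (c • (w - P w)))
      ((innerSL ℝ : (EuclideanSpace ℝ (Fin n)) →L[ℝ] (EuclideanSpace ℝ (Fin n)) →L[ℝ] ℝ).comp (c • (ContinuousLinearMap.id ℝ (EuclideanSpace ℝ (Fin n)) - M))) z :=
    (innerSL ℝ : (EuclideanSpace ℝ (Fin n)) →L[ℝ] (EuclideanSpace ℝ (Fin n)) →L[ℝ] ℝ).hasFDerivAt.comp z h1
  have h3 := second_derivative_symmetric (fun y => env_hasFDeriv hP hρ hc y) h2 a b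
  simp only [ContinuousLinearMap.comp_apply, _root_.smul_apply,
    _root_.sub_apply, ContinuousLinearMap.id_apply, innerSL_apply_apply,
    inner_smul_left, inner_sub_left, conj_trivial] at h3
  have hc0 : c ≠ 0 := by linarith
  have h4 := mul_left_cancel₀ hc0 h3
  rw [real_inner_comm b a] at h4
  rw [real_inner_comm (M b) a]
  linarith

/-- difference quotient of the proximal map -/
def quo (P : (EuclideanSpace ℝ (Fin n)) → (EuclideanSpace ℝ (Fin n))) (z h : (EuclideanSpace ℝ (Fin n))) (τ : ℝ) : (EuclideanSpace ℝ (Fin n)) := τ⁻¹ • (P (z + τ • h) - P z)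

lemma quo_tendsto {P : (EuclideanSpace ℝ (Fin n)) → (EuclideanSpace ℝ (Fin n))} {z : (EuclideanSpace ℝ (Fin n))} {M : (EuclideanSpace ℝ (Fin n)) →L[ℝ] (EuclideanSpace ℝ (Fin n))} (hM : HasFDerivAt P M z) (h : (EuclideanSpace ℝ (Fin n))) :
    Tendsto (quo P z h) (𝓝[>] 0) (𝓝 (M h)) := by
  have h1 := (hM.hasLineDerivAt h).tendsto_slope_zero
  exact h1.mono_left (nhdsWithin_mono _ (fun t ht => ne_of_gt ht))

lemma add_smul_quo {P : (EuclideanSpace ℝ (Fin n)) → (EuclideanSpace ℝ (Fin n))} {z h : (EuclideanSpace ℝ (Fin n))} {τ : ℝ} (hτ : τ ≠ 0) :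
    P z + τ • quo P z h τ = P (z + τ • h) := by
  rw [quo, smul_inv_smul₀ hτ]; abel

/-- value of the second difference quotient along the proximal curve -/
def val (c : ℝ) (φ : (EuclideanSpace ℝ (Fin n)) → EReal) (P : (EuclideanSpace ℝ (Fin n)) → (EuclideanSpace ℝ (Fin n))) (z h : (EuclideanSpace ℝ (Fin n))) (τ : ℝ) : ℝ :=
  2 / τ ^ 2 * ((φ (P (z + τ • h))).toReal - (φ (P z)).toReal
    - τ * ⟪c • (z - P z), quo P z h τ⟫)

lemma val_eq {c : ℝ} {φ : (EuclideanSpace ℝ (Fin n)) → EReal} {P : (EuclideanSpace ℝ (Fin n)) → (EuclideanSpace ℝ (Fin n))} {z h : (EuclideanSpace ℝ (Fin n))} {τ : ℝ} (hτ : τ ≠ 0) :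
    val c φ P z h τ = 2 * ((env c φ P (z + τ • h) - env c φ P z - τ * ⟪c • (z - P z), h⟫) / τ ^ 2)
      - c * ‖quo P z h τ - h‖ ^ 2 := by
  have h1 := add_smul_quo (P := P) (z := z) (h := h) hτ
  have h2 : P (z + τ • h) - (z + τ • h) = τ • (quo P z h τ - h) - (z - P z) := by
    rw [← h1]; module
  simp only [val, env]
  rw [h2, norm_sub_sq_real, norm_smul, inner_smul_left, mul_pow, Real.norm_eq_abs, sq_abs,
    norm_sub_rev (P z) z]
  simp only [inner_smul_left, conj_trivial, inner_sub_left (quo P z h τ),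
    real_inner_comm (z - P z) (quo P z h τ), real_inner_comm (z - P z) h]
  field_simp
  ring

lemma val_tendsto {ρ c : ℝ} {φ : (EuclideanSpace ℝ (Fin n)) → EReal} {P : (EuclideanSpace ℝ (Fin n)) → (EuclideanSpace ℝ (Fin n))} (hP : IsProx ρ c φ P) (hρ : 0 ≤ ρ)
    (hc : ρ < c) {z : (EuclideanSpace ℝ (Fin n))} {M : (EuclideanSpace ℝ (Fin n)) →L[ℝ] (EuclideanSpace ℝ (Fin n))} (hM : HasFDerivAt P M z) (h : (EuclideanSpace ℝ (Fin n))) :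
    Tendsto (val c φ P z h) (𝓝[>] 0) (𝓝 (c * ⟪M h, h - M h⟫)) := by
  have hquo := quo_tendsto hM h
  have hline : ∀ τ : ℝ, HasDerivAt (fun τ : ℝ => z + τ • h) h τ := fun τ => by
    simpa using ((hasDerivAt_id τ).smul_const h).const_add z
  have hd : ∀ τ : ℝ, HasDerivAt
      (fun τ : ℝ => env c φ P (z + τ • h) - env c φ P z - τ * ⟪c • (z - P z), h⟫)
      (⟪c • (z + τ • h - P (z + τ • h)), h⟫ - ⟪c • (z - P z), h⟫) τ := by
    intro τ
    have h1 := (env_hasFDeriv hP hρ hc (z + τ • h)).comp_hasDerivAt τ (hline τ)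
    have h2 := (h1.sub_const (env c φ P z)).sub ((hasDerivAt_id τ).mul_const ⟪c • (z - P z), h⟫)
    rw [innerSL_apply_apply, one_mul] at h2
    exact h2
  have hT : Tendsto (fun τ : ℝ => (env c φ P (z + τ • h) - env c φ P z - τ * ⟪c • (z - P z), h⟫)
      / τ ^ 2) (𝓝[>] 0) (𝓝 (c * ⟪h - M h, h⟫ / 2)) := by
    refine HasDerivAt.lhopital_zero_nhdsGT (Eventually.of_forall hd)
      (g' := fun τ => 2 * τ) (Eventually.of_forall fun τ => by
        simpa using hasDerivAt_pow 2 τ) ?_ ?_ ?_ ?_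
    · filter_upwards [self_mem_nhdsWithin] with τ hτ
      have : (0 : ℝ) < τ := hτ
      positivity
    · have := (hd 0).continuousAt.tendsto
      simp only [zero_smul, add_zero, sub_self, zero_mul] at this
      exact this.mono_left nhdsWithin_le_nhds
    · have : Continuous fun τ : ℝ => τ ^ 2 := by fun_prop
      have := this.tendsto 0
      simp only [ne_eq, OfNat.ofNat_ne_zero, not_false_eq_true, zero_pow] at this
      exact this.mono_left nhdsWithin_le_nhds
    · have h1 : Tendsto (fun τ => c * ⟪h - quo P z h τ, h⟫ / 2) (𝓝[>] 0)
          (𝓝 (c * ⟪h - M h, h⟫ / 2)) :=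
        (((tendsto_const_nhds.sub hquo).inner tendsto_const_nhds).const_mul c).div_const 2
      refine h1.congr' ?_
      filter_upwards [self_mem_nhdsWithin] with τ hτ
      have hτ0 : τ ≠ 0 := ne_of_gt hτ
      rw [← add_smul_quo (P := P) (z := z) (h := h) hτ0, ← inner_sub_left]
      have : c • (z + τ • h - (P z + τ • quo P z h τ)) - c • (z - P z)
          = (τ * c) • (h - quo P z h τ) := by module
      rw [this, inner_smul_left]
      simp only [conj_trivial]
      field_simp
  have hT2 : Tendsto (fun τ => c * ‖quo P z h τ - h‖ ^ 2) (𝓝[>] 0) (𝓝 (c * ‖M h - h‖ ^ 2)) :=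
    ((hquo.sub tendsto_const_nhds).norm.pow 2).const_mul c
  have hT3 := (hT.const_mul 2).sub hT2
  have heq : 2 * (c * ⟪h - M h, h⟫ / 2) - c * ‖M h - h‖ ^ 2 = c * ⟪M h, h - M h⟫ := by
    rw [← real_inner_self_eq_norm_sq]
    simp only [inner_sub_left, inner_sub_right, real_inner_comm (M h) h]
    ring
  rw [heq] at hT3
  refine hT3.congr' ?_
  filter_upwards [self_mem_nhdsWithin] with τ hτ
  rw [val_eq (ne_of_gt hτ)]

lemma delta2_eq {φ : (EuclideanSpace ℝ (Fin n)) → EReal} {x v u : (EuclideanSpace ℝ (Fin n))} {τ : ℝ} (hnotbot : ∀ x, φ x ≠ ⊥)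
    (hx : φ x ≠ ⊤) (hu : φ (x + τ • u) ≠ ⊤) :
    delta2 φ x v τ u = ((2 / τ ^ 2 * ((φ (x + τ • u)).toReal - (φ x).toReal - τ * ⟪v, u⟫) : ℝ) : EReal) := by
  rw [delta2]
  have h1 := hnotbot (x + τ • u)
  lift φ x to ℝ using ⟨hx, hnotbot x⟩ with fx
  lift φ (x + τ • u) to ℝ using ⟨hu, h1⟩ with fu
  norm_cast

lemma delta2_top {φ : (EuclideanSpace ℝ (Fin n)) → EReal} {x v u : (EuclideanSpace ℝ (Fin n))} {τ : ℝ} (hnotbot : ∀ x, φ x ≠ ⊥)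
    (hx : φ x ≠ ⊤) (hτ : 0 < τ) (hu : φ (x + τ • u) = ⊤) : delta2 φ x v τ u = ⊤ := by
  rw [delta2, hu]
  lift φ x to ℝ using ⟨hx, hnotbot x⟩ with fx
  rw [EReal.top_sub_coe, EReal.top_sub_coe, EReal.coe_mul_top_of_pos (by positivity)]

lemma delta2_quo {ρ c : ℝ} {φ : (EuclideanSpace ℝ (Fin n)) → EReal} {P : (EuclideanSpace ℝ (Fin n)) → (EuclideanSpace ℝ (Fin n))} (hnotbot : ∀ x, φ x ≠ ⊥)
    (hP : IsProx ρ c φ P) {z h : (EuclideanSpace ℝ (Fin n))} {τ : ℝ} (hτ : 0 < τ) :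
    delta2 φ (P z) (c • (z - P z)) τ (quo P z h τ) = ((val c φ P z h τ : ℝ) : EReal) := by
  have h1 := add_smul_quo (P := P) (z := z) (h := h) hτ.ne'
  rw [delta2_eq hnotbot (hP z).1 (by rw [h1]; exact (hP _).1), h1, val]

/-- lower bound for the second order quotient -/
def lowb (ρ c : ℝ) (φ : (EuclideanSpace ℝ (Fin n)) → EReal) (P : (EuclideanSpace ℝ (Fin n)) → (EuclideanSpace ℝ (Fin n))) (z h : (EuclideanSpace ℝ (Fin n))) (p : ℝ × (EuclideanSpace ℝ (Fin n))) : ℝ :=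
  val c φ P z h p.1 + 2 * c * ⟪h - quo P z h p.1, p.2 - quo P z h p.1⟫
    - ρ * ‖p.2 - quo P z h p.1‖ ^ 2

lemma lowb_le {ρ c : ℝ} {φ : (EuclideanSpace ℝ (Fin n)) → EReal} {P : (EuclideanSpace ℝ (Fin n)) → (EuclideanSpace ℝ (Fin n))} (hnotbot : ∀ x, φ x ≠ ⊥)
    (hP : IsProx ρ c φ P) {z h u : (EuclideanSpace ℝ (Fin n))} {τ : ℝ} (hτ : 0 < τ) :
    ((lowb ρ c φ P z h (τ, u) : ℝ) : EReal) ≤ delta2 φ (P z) (c • (z - P z)) τ u := by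
  by_cases hu : φ (P z + τ • u) = ⊤
  · rw [delta2_top hnotbot (hP z).1 hτ hu]; exact le_top
  rw [delta2_eq hnotbot (hP z).1 hu, EReal.coe_le_coe_iff]
  have h1 := add_smul_quo (P := P) (z := z) (h := h) hτ.ne'
  have h2 := (hP (z + τ • h)).2 _ hu
  simp only [lowb, val]
  rw [← h1] at h2 ⊢
  set q := quo P z h τ
  have h3 : P z + τ • u - (P z + τ • q) = τ • (u - q) := by module
  have h4 : z + τ • h - (P z + τ • q) = (z - P z) + τ • (h - q) := by module
  rw [h3, h4, norm_smul, mul_pow, Real.norm_eq_abs, sq_abs, inner_smul_right, inner_add_left,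
    inner_smul_left, inner_sub_right (z - P z)] at h2
  simp only [inner_smul_left, conj_trivial] at h2 ⊢
  have h5 := mul_le_mul_of_nonneg_left h2 (by positivity : 0 ≤ 2 / τ ^ 2)
  have h6 : 2 / τ ^ 2 * τ ^ 2 = 2 := by field_simp
  have e1 : 2 / τ ^ 2 * ((φ (P z + τ • q)).toReal +
      c * (τ * (⟪z - P z, u⟫ - ⟪z - P z, q⟫ + τ * ⟪h - q, u - q⟫)) - ρ / 2 * (τ ^ 2 * ‖u - q‖ ^ 2))
      = 2 / τ ^ 2 * (φ (P z + τ • q)).toReal + 2 / τ ^ 2 * (τ * (c * ⟪z - P z, u⟫))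
        - 2 / τ ^ 2 * (τ * (c * ⟪z - P z, q⟫)) + 2 * c * ⟪h - q, u - q⟫ - ρ * ‖u - q‖ ^ 2 := by
    linear_combination (c * ⟪h - q, u - q⟫ - ρ / 2 * ‖u - q‖ ^ 2) * h6
  nlinarith

lemma lowb_tendsto {ρ c : ℝ} {φ : (EuclideanSpace ℝ (Fin n)) → EReal} {P : (EuclideanSpace ℝ (Fin n)) → (EuclideanSpace ℝ (Fin n))} (hP : IsProx ρ c φ P) (hρ : 0 ≤ ρ)
    (hc : ρ < c) {z : (EuclideanSpace ℝ (Fin n))} {M : (EuclideanSpace ℝ (Fin n)) →L[ℝ] (EuclideanSpace ℝ (Fin n))} (hM : HasFDerivAt P M z) (h w : (EuclideanSpace ℝ (Fin n))) :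
    Tendsto (lowb ρ c φ P z h) (𝓝[>] 0 ×ˢ 𝓝 w)
      (𝓝 (c * ⟪M h, h - M h⟫ + 2 * c * ⟪h - M h, w - M h⟫ - ρ * ‖w - M h‖ ^ 2)) := by
  have h1 : Tendsto (fun p : ℝ × (EuclideanSpace ℝ (Fin n)) => val c φ P z h p.1) (𝓝[>] 0 ×ˢ 𝓝 w) _ :=
    (val_tendsto hP hρ hc hM h).comp tendsto_fst
  have h2 : Tendsto (fun p : ℝ × (EuclideanSpace ℝ (Fin n)) => quo P z h p.1) (𝓝[>] 0 ×ˢ 𝓝 w) _ :=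
    (quo_tendsto hM h).comp tendsto_fst
  have h3 : Tendsto (fun p : ℝ × (EuclideanSpace ℝ (Fin n)) => p.2) (𝓝[>] (0:ℝ) ×ˢ 𝓝 w) (𝓝 w) := tendsto_snd
  exact (h1.add (((tendsto_const_nhds.sub h2).inner (h3.sub h2)).const_mul (2 * c))).sub
    (((h3.sub h2).norm.pow 2).const_mul ρ)

lemma le_secondSubderiv {ρ c : ℝ} {φ : (EuclideanSpace ℝ (Fin n)) → EReal} {P : (EuclideanSpace ℝ (Fin n)) → (EuclideanSpace ℝ (Fin n))} (hnotbot : ∀ x, φ x ≠ ⊥)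
    (hP : IsProx ρ c φ P) (hρ : 0 ≤ ρ)
    (hc : ρ < c) {z : (EuclideanSpace ℝ (Fin n))} {M : (EuclideanSpace ℝ (Fin n)) →L[ℝ] (EuclideanSpace ℝ (Fin n))} (hM : HasFDerivAt P M z) (h w : (EuclideanSpace ℝ (Fin n))) :
    ((c * ⟪M h, h - M h⟫ + 2 * c * ⟪h - M h, w - M h⟫ - ρ * ‖w - M h‖ ^ 2 : ℝ) : EReal)
      ≤ secondSubderiv φ (P z) (c • (z - P z)) w := by
  have h1 := (continuous_coe_real_ereal.tendsto _).comp (lowb_tendsto hP hρ hc hM h w)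
  rw [← h1.liminf_eq]
  refine liminf_le_liminf ?_
  have h2 : ∀ᶠ p : ℝ × (EuclideanSpace ℝ (Fin n)) in 𝓝[>] 0 ×ˢ 𝓝 w, 0 < p.1 :=
    tendsto_fst.eventually (self_mem_nhdsWithin : ∀ᶠ t : ℝ in 𝓝[>] 0, 0 < t)
  filter_upwards [h2] with p hp
  exact lowb_le hnotbot hP hp

lemma secondSubderiv_range {ρ c : ℝ} {φ : (EuclideanSpace ℝ (Fin n)) → EReal} {P : (EuclideanSpace ℝ (Fin n)) → (EuclideanSpace ℝ (Fin n))} (hnotbot : ∀ x, φ x ≠ ⊥)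
    (hP : IsProx ρ c φ P) (hρ : 0 ≤ ρ)
    (hc : ρ < c) {z : (EuclideanSpace ℝ (Fin n))} {M : (EuclideanSpace ℝ (Fin n)) →L[ℝ] (EuclideanSpace ℝ (Fin n))} (hM : HasFDerivAt P M z) (h : (EuclideanSpace ℝ (Fin n))) :
    Tendsto (fun τ => delta2 φ (P z) (c • (z - P z)) τ (quo P z h τ)) (𝓝[>] 0)
      (𝓝 ((c * ⟪M h, h - M h⟫ : ℝ) : EReal)) ∧
    secondSubderiv φ (P z) (c • (z - P z)) (M h) = ((c * ⟪M h, h - M h⟫ : ℝ) : EReal) := by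
  have h1 : Tendsto (fun τ => delta2 φ (P z) (c • (z - P z)) τ (quo P z h τ)) (𝓝[>] 0)
      (𝓝 ((c * ⟪M h, h - M h⟫ : ℝ) : EReal)) := by
    refine ((continuous_coe_real_ereal.tendsto _).comp (val_tendsto hP hρ hc hM h)).congr' ?_
    filter_upwards [self_mem_nhdsWithin] with τ hτ
    exact (delta2_quo hnotbot hP hτ).symm
  refine ⟨h1, le_antisymm ?_ ?_⟩
  · have h2 : Tendsto (fun τ => (τ, quo P z h τ)) (𝓝[>] (0:ℝ)) (𝓝[>] (0:ℝ) ×ˢ 𝓝 (M h)) :=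
      tendsto_id.prodMk (quo_tendsto hM h)
    rw [← h1.liminf_eq]
    exact liminf_le_liminf_of_le (f := 𝓝[>] (0:ℝ) ×ˢ 𝓝 (M h))
      (u := fun p : ℝ × (EuclideanSpace ℝ (Fin n)) => delta2 φ (P z) (c • (z - P z)) p.1 p.2) h2
  · have := le_secondSubderiv hnotbot hP hρ hc hM h (M h)
    simpa using this

lemma secondSubderiv_not_range {ρ c : ℝ} {φ : (EuclideanSpace ℝ (Fin n)) → EReal} {P : (EuclideanSpace ℝ (Fin n)) → (EuclideanSpace ℝ (Fin n))} (hnotbot : ∀ x, φ x ≠ ⊥)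
    (hP : IsProx ρ c φ P) (hρ : 0 ≤ ρ)
    (hc : ρ < c) {z : (EuclideanSpace ℝ (Fin n))} {M : (EuclideanSpace ℝ (Fin n)) →L[ℝ] (EuclideanSpace ℝ (Fin n))} (hM : HasFDerivAt P M z) (w : (EuclideanSpace ℝ (Fin n)))
    (hw : w ∉ LinearMap.range (M : (EuclideanSpace ℝ (Fin n)) →ₗ[ℝ] (EuclideanSpace ℝ (Fin n)))) :
    secondSubderiv φ (P z) (c • (z - P z)) w = ⊤ := by
  obtain ⟨k, hk, hkw⟩ : ∃ k ∈ (LinearMap.range (M : (EuclideanSpace ℝ (Fin n)) →ₗ[ℝ] (EuclideanSpace ℝ (Fin n))))ᗮ, ⟪k, w⟫ ≠ 0 := by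
    by_contra hcon
    push Not at hcon
    apply hw
    rw [← Submodule.orthogonal_orthogonal (LinearMap.range (M : (EuclideanSpace ℝ (Fin n)) →ₗ[ℝ] (EuclideanSpace ℝ (Fin n)))),
      Submodule.mem_orthogonal]
    exact hcon
  have hMk : M k = 0 := by
    rw [← inner_self_eq_zero (𝕜 := ℝ), prox_symm hP hρ hc hM, real_inner_comm]
    exact (Submodule.mem_orthogonal _ _).1 hk _ ⟨M k, rfl⟩
  rw [EReal.eq_top_iff_forall_lt]
  intro y
  set s := (y + 1 + ρ * ‖w‖ ^ 2) / (2 * c * ⟪k, w⟫) with hs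
  have h1 := le_secondSubderiv hnotbot hP hρ hc hM (s • k) w
  rw [map_smul, hMk, smul_zero, inner_zero_left, sub_zero, sub_zero, inner_smul_left] at h1
  refine lt_of_lt_of_le ?_ h1
  rw [EReal.coe_lt_coe_iff]
  have h2 : 2 * c * (s * ⟪k, w⟫) = y + 1 + ρ * ‖w‖ ^ 2 := by
    have : c ≠ 0 := by linarith
    rw [hs]; field_simp
  simp only [conj_trivial]
  linarith

lemma exists_pinv (M : (EuclideanSpace ℝ (Fin n)) →ₗ[ℝ] (EuclideanSpace ℝ (Fin n))) (hsym : ∀ a b, ⟪M a, b⟫ = ⟪a, M b⟫) (c : ℝ) :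
    ∃ A : (EuclideanSpace ℝ (Fin n)) →ₗ[ℝ] (EuclideanSpace ℝ (Fin n)), (∀ u w, ⟪A u, w⟫ = ⟪u, A w⟫) ∧
      ∀ h, ⟪M h, A (M h)⟫ = c * ⟪M h, h - M h⟫ := by
  obtain ⟨S, hS⟩ := M.rangeRestrict.exists_rightInverse_of_surjective
    (LinearMap.range_rangeRestrict M)
  obtain ⟨T, hT⟩ := S.exists_extend
  have hMT : ∀ h, M (T (M h)) = M h := by
    intro h
    have h1 : T (M h) = S ⟨M h, h, rfl⟩ := by rw [← hT]; rfl
    have h2 := LinearMap.congr_fun hS ⟨M h, h, rfl⟩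
    rw [h1]
    exact congrArg Subtype.val h2
  refine ⟨c • (T.adjoint ∘ₗ M ∘ₗ T - LinearMap.id), ?_, ?_⟩
  · intro u w
    simp only [LinearMap.smul_apply, LinearMap.sub_apply, LinearMap.comp_apply, LinearMap.id_apply,
      inner_smul_left, inner_smul_right, inner_sub_left, inner_sub_right, conj_trivial,
      LinearMap.adjoint_inner_left, LinearMap.adjoint_inner_right, hsym]
  · intro h
    simp only [LinearMap.smul_apply, LinearMap.sub_apply, LinearMap.comp_apply, LinearMap.id_apply,
      inner_smul_right, inner_sub_right, LinearMap.adjoint_inner_right, hMT]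
    rw [← hsym (T (M h)) h, hMT]

lemma prox_mem {ρ c : ℝ} {φ : (EuclideanSpace ℝ (Fin n)) → EReal} {P : (EuclideanSpace ℝ (Fin n)) → (EuclideanSpace ℝ (Fin n))} (hnotbot : ∀ x, φ x ≠ ⊥)
    (hP : IsProx ρ c φ P) (z : (EuclideanSpace ℝ (Fin n))) : (P z, c • (z - P z)) ∈ gphSubdiff ρ φ := by
  refine ⟨(hP z).1, fun u => ?_⟩
  by_cases hu : φ u = ⊤
  · rw [hu]; exact le_top
  have h1 := (hP z).2 u hu
  have h2 := (hP z).1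
  simp only
  rw [inner_smul_left]
  lift φ u to ℝ using ⟨hu, hnotbot u⟩ with fu
  lift φ (P z) to ℝ using ⟨h2, hnotbot (P z)⟩ with fp
  norm_cast
  simp only [EReal.toReal_coe, conj_trivial] at *
  linarith

lemma gen_twice {ρ c : ℝ} {φ : (EuclideanSpace ℝ (Fin n)) → EReal} {P : (EuclideanSpace ℝ (Fin n)) → (EuclideanSpace ℝ (Fin n))} (hnotbot : ∀ x, φ x ≠ ⊥)
    (hP : IsProx ρ c φ P) (hρ : 0 ≤ ρ)
    (hc : ρ < c) {z : (EuclideanSpace ℝ (Fin n))} {M : (EuclideanSpace ℝ (Fin n)) →L[ℝ] (EuclideanSpace ℝ (Fin n))} (hM : HasFDerivAt P M z) :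
    GenTwiceDiff φ (P z) (c • (z - P z)) := by
  constructor
  · intro w τ hτ hτ0
    have hτ' : Tendsto τ atTop (𝓝[>] 0) :=
      tendsto_nhdsWithin_iff.2 ⟨hτ0, Eventually.of_forall hτ⟩
    by_cases hw : w ∈ LinearMap.range (M : (EuclideanSpace ℝ (Fin n)) →ₗ[ℝ] (EuclideanSpace ℝ (Fin n)))
    · obtain ⟨h, rfl⟩ := hw
      obtain ⟨h1, h2⟩ := secondSubderiv_range hnotbot hP hρ hc hM h
      refine ⟨fun k => quo P z h (τ k), (quo_tendsto hM h).comp hτ', ?_⟩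
      have h3 := h1.comp hτ'
      rw [← h2] at h3
      exact h3
    · refine ⟨fun _ => w, tendsto_const_nhds, ?_⟩
      have h1 := secondSubderiv_not_range hnotbot hP hρ hc hM w hw
      rw [h1]
      have h2 : Tendsto (fun k => (τ k, w)) atTop (𝓝[>] (0:ℝ) ×ˢ 𝓝 w) :=
        hτ'.prodMk tendsto_const_nhds
      rw [EReal.tendsto_nhds_top_iff_real]
      intro y
      have h3 : (y : EReal) < secondSubderiv φ (P z) (c • (z - P z)) w := by
        rw [h1]; exact EReal.coe_lt_top y
      exact h2.eventually (eventually_lt_of_lt_liminf h3)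
  · obtain ⟨A, hA, hA2⟩ := exists_pinv (M : (EuclideanSpace ℝ (Fin n)) →ₗ[ℝ] (EuclideanSpace ℝ (Fin n))) (prox_symm hP hρ hc hM) c
    refine ⟨A, LinearMap.range (M : (EuclideanSpace ℝ (Fin n)) →ₗ[ℝ] (EuclideanSpace ℝ (Fin n))), hA, ?_, ?_⟩
    · rintro w ⟨h, rfl⟩
      rw [hA2]
      exact (secondSubderiv_range hnotbot hP hρ hc hM h).2
    · intro w hw
      exact secondSubderiv_not_range hnotbot hP hρ hc hM w hw

lemma env_convex {ρ c : ℝ} {φ : (EuclideanSpace ℝ (Fin n)) → EReal} {P : (EuclideanSpace ℝ (Fin n)) → (EuclideanSpace ℝ (Fin n))} (hnotbot : ∀ x, φ x ≠ ⊥)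
    (hP : IsProx ρ c φ P) (hρ : 0 ≤ ρ) (hc : ρ < c)
    (hyp : ∀ x v : (EuclideanSpace ℝ (Fin n)), (x, v) ∈ gphSubdiff ρ φ →
      GenTwiceDiff φ x v → ∀ w : (EuclideanSpace ℝ (Fin n)), 0 ≤ secondSubderiv φ x v w)
    (x y : (EuclideanSpace ℝ (Fin n))) (a b : ℝ) (ha : 0 ≤ a) (hb : 0 ≤ b) (hab : a + b = 1) :
    env c φ P (a • x + b • y) ≤ a * env c φ P x + b * env c φ P y := by
  have hc0 : 0 < c := by linarith
  have hL := prox_lip hP hρ hc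
  have hae : ∀ᵐ z : (EuclideanSpace ℝ (Fin n)), ∀ h : (EuclideanSpace ℝ (Fin n)), 0 ≤ ⟪h, h - fderiv ℝ P z h⟫ := by
    filter_upwards [hL.ae_differentiableAt] with z hz h
    have hM := hz.hasFDerivAt
    have h1 := hyp _ _ (prox_mem hnotbot hP z) (gen_twice hnotbot hP hρ hc hM) (fderiv ℝ P z h)
    rw [(secondSubderiv_range hnotbot hP hρ hc hM h).2] at h1
    have h2 : 0 ≤ c * ⟪fderiv ℝ P z h, h - fderiv ℝ P z h⟫ := by exact_mod_cast h1
    have h3 := nonneg_of_mul_nonneg_right h2 hc0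
    have h4 : ⟪h, h - fderiv ℝ P z h⟫ = ⟪fderiv ℝ P z h, h - fderiv ℝ P z h⟫
        + ⟪h - fderiv ℝ P z h, h - fderiv ℝ P z h⟫ := by
      rw [← inner_add_left]; congr 1; abel
    rw [h4]
    exact add_nonneg h3 real_inner_self_nonneg
  have hmono : ∀ h z : (EuclideanSpace ℝ (Fin n)), ⟪z - P z, h⟫ ≤ ⟪(z + h) - P (z + h), h⟫ := by
    intro h
    have hid : LipschitzWith 1 (fun z : (EuclideanSpace ℝ (Fin n)) => z) := LipschitzWith.id
    have hg1 := ((innerSL ℝ h).lipschitz).comp (hid.sub hL)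
    have hg2 : ∀ z, ((innerSL ℝ h) ∘ fun z => z - P z) z = ⟪z - P z, h⟫ := by
      intro z; simp [real_inner_comm]
    intro z
    rw [← hg2, ← hg2]
    refine mono_of_ae_fderiv hg1 h ?_ z
    filter_upwards [hae, hL.ae_differentiableAt] with z hz hd
    have h1 : HasFDerivAt (fun w => w - P w) (ContinuousLinearMap.id ℝ (EuclideanSpace ℝ (Fin n)) - fderiv ℝ P z) z :=
      (hasFDerivAt_id z).sub hd.hasFDerivAt
    have h2 := (innerSL ℝ h).hasFDerivAt.comp z h1
    rw [h2.fderiv]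
    exact hz h
  have hline : ∀ τ : ℝ, HasDerivAt (fun τ : ℝ => x + τ • (y - x)) (y - x) τ := fun τ => by
    simpa using ((hasDerivAt_id τ).smul_const (y - x)).const_add x
  have hd : ∀ τ : ℝ, HasDerivAt (fun τ : ℝ => env c φ P (x + τ • (y - x)))
      (c * ⟪x + τ • (y - x) - P (x + τ • (y - x)), y - x⟫) τ := by
    intro τ
    have h1 := (env_hasFDeriv hP hρ hc (x + τ • (y - x))).comp_hasDerivAt τ (hline τ)
    rw [innerSL_apply_apply, inner_smul_left] at h1
    exact h1
  have hconv : ConvexOn ℝ univ (fun τ : ℝ => env c φ P (x + τ • (y - x))) := by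
    refine Monotone.convexOn_univ_of_deriv (fun τ => (hd τ).differentiableAt) ?_
    intro s t hst
    rw [(hd s).deriv, (hd t).deriv]
    refine mul_le_mul_of_nonneg_left ?_ hc0.le
    rcases hst.eq_or_lt with rfl | hst
    · exact le_rfl
    have h1 := hmono ((t - s) • (y - x)) (x + s • (y - x))
    have h2 : x + s • (y - x) + (t - s) • (y - x) = x + t • (y - x) := by module
    rw [h2, inner_smul_right, inner_smul_right] at h1
    exact le_of_mul_le_mul_left h1 (by linarith)
  have h1 := hconv.2 (mem_univ (0:ℝ)) (mem_univ (1:ℝ)) ha hb hab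
  simp only [smul_eq_mul, mul_zero, mul_one, zero_add, zero_smul, add_zero, one_smul] at h1
  have h2 : x + b • (y - x) = a • x + b • y := by
    obtain rfl : a = 1 - b := by linarith
    module
  rw [h2] at h1
  simpa using h1

end Helpers

/-- a weakly convex function whose second subderivatives are
nonnegative at all points of generalized twice differentiability is convex. -/
theorem statement10 (n : ℕ) (φ : EuclideanSpace ℝ (Fin n) → EReal)
    (hnotbot : ∀ x, φ x ≠ ⊥) (hproper : ∃ x, φ x ≠ ⊤)
    (hlsc : LowerSemicontinuous φ)
    (ρ : ℝ) (hρ : 0 ≤ ρ) (hweak : ERealConvex (shiftFun ρ φ))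
    (hyp : ∀ x v : EuclideanSpace ℝ (Fin n), (x, v) ∈ gphSubdiff ρ φ →
      GenTwiceDiff φ x v → ∀ w : EuclideanSpace ℝ (Fin n), 0 ≤ secondSubderiv φ x v w) :
    ERealConvex φ := by
  intro x y a b ha hb hab
  rcases ha.eq_or_lt with rfl | ha'
  · obtain rfl : b = 1 := by linarith
    simp
  rcases hb.eq_or_lt with rfl | hb'
  · obtain rfl : a = 1 := by linarith
    simp
  have hmb : ∀ (r : ℝ) (u : EuclideanSpace ℝ (Fin n)), 0 < r → (r : EReal) * φ u ≠ ⊥ := by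
    intro r u hr
    by_cases hu : φ u = ⊤
    · rw [hu, EReal.coe_mul_top_of_pos hr]; exact top_ne_bot
    · lift φ u to ℝ using ⟨hu, hnotbot u⟩ with fu
      norm_cast
      exact EReal.coe_ne_bot _
  by_cases hx : φ x = ⊤
  · rw [hx, EReal.coe_mul_top_of_pos ha', EReal.top_add_of_ne_bot (hmb b y hb')]
    exact le_top
  by_cases hy : φ y = ⊤
  · rw [hy, EReal.coe_mul_top_of_pos hb', EReal.add_top_of_ne_bot (hmb a x ha')]
    exact le_top
  have hW := wc_of_weak hnotbot hweak
  set p := a • x + b • y with hp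
  set R := a * (φ x).toReal + b * (φ y).toReal with hR
  have hRe : (a : EReal) * φ x + (b : EReal) * φ y = (R : EReal) := by
    rw [hR]
    lift φ x to ℝ using ⟨hx, hnotbot x⟩ with fx
    lift φ y to ℝ using ⟨hy, hnotbot y⟩ with fy
    norm_cast
  rw [hRe]
  -- proximal maps for every parameter
  have hex : ∀ k : ℕ, ∃ P, IsProx ρ (ρ + 1 + k) φ P := fun k =>
    exists_prox hnotbot hproper hlsc hρ hW (by have : (0:ℝ) ≤ k := k.cast_nonneg; linarith)
  choose P hP using hex
  have hck : ∀ k : ℕ, ρ < ρ + 1 + k := fun k => by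
    have : (0:ℝ) ≤ k := k.cast_nonneg
    linarith
  have henv : ∀ k : ℕ, env (ρ + 1 + k) φ (P k) p ≤ R := by
    intro k
    have h1 := env_convex hnotbot (hP k) hρ (hck k) hyp x y a b ha hb hab
    have h2 := env_le (hP k) (hck k) x x hx
    have h3 := env_le (hP k) (hck k) y y hy
    simp only [sub_self, norm_zero, ne_eq, OfNat.ofNat_ne_zero, not_false_eq_true, zero_pow,
      mul_zero, add_zero] at h2 h3
    have h4 := mul_le_mul_of_nonneg_left h2 ha
    have h5 := mul_le_mul_of_nonneg_left h3 hb
    linarith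
  set m := env (ρ + 1 + (0 : ℕ)) φ (P 0) p with hm
  have hdist : ∀ k : ℕ, (k : ℝ) * ‖P k p - p‖ ^ 2 ≤ 2 * (R - m) := by
    intro k
    have h1 := env_le (hP 0) (hck 0) p (P k p) (hP k p).1
    rw [← hm] at h1
    have h2 := henv k
    simp only [env] at h2
    push_cast at h1
    linarith
  have hval : ∀ k : ℕ, φ (P k p) ≤ (R : EReal) := by
    intro k
    have h2 := henv k
    simp only [env] at h2
    have h3 : 0 ≤ (ρ + 1 + k) / 2 * ‖P k p - p‖ ^ 2 := by
      have : (0:ℝ) ≤ k := k.cast_nonneg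
      positivity
    have h4 := (hP k p).1
    lift φ (P k p) to ℝ using ⟨h4, hnotbot _⟩ with f
    simp only [EReal.toReal_coe] at h2
    norm_cast
    linarith
  have hlim : Tendsto (fun k => P k p) atTop (𝓝 p) := by
    rw [tendsto_iff_norm_sub_tendsto_zero]
    have h1 : Tendsto (fun k : ℕ => 2 * (R - m) / (k : ℝ)) atTop (𝓝 0) :=
      tendsto_const_div_atTop_nhds_zero_nat _
    have h2 : Tendsto (fun k => ‖P k p - p‖ ^ 2) atTop (𝓝 0) := by
      refine squeeze_zero' (Eventually.of_forall fun k => by positivity) ?_ h1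
      filter_upwards [eventually_gt_atTop 0] with k hk
      have : (0:ℝ) < k := by exact_mod_cast hk
      rw [le_div_iff₀ this]
      linarith [hdist k]
    have h3 := h2.sqrt
    simpa using h3
  by_contra hlt
  push Not at hlt
  obtain ⟨k, hk⟩ := (hlim.eventually (hlsc p _ hlt)).exists
  exact absurd (hval k) (not_le.2 hk)

end
end

section
/- Let φ : ℝⁿ → ℝ ∪ {+∞} be proper, lower semicontinuous and ρ-weakly convex for some ρ ≥ 0, and let κ > 0. Then φ is strongly convex with modulus κ (i.e., x ↦ φ(x) − (κ/2)‖x‖² is convex) if and only if d²φ(x,v)(w) ≥ κ‖w‖² for every (x,v) ∈ gph ∂φ and every w ∈ ℝⁿ. -/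
open scoped RealInnerProductSpace
open Filter Topology MeasureTheory Set

noncomputable section

variable {n : ℕ}

theorem aux_max (q : ℝ → ℝ) (hq : ContinuousOn q (Icc 0 1)) (h0 : q 0 = 0) (h1 : q 1 = 0)
    (H : ∀ c ∈ Ioo (0:ℝ) 1, ∃ τ, c + τ ∈ Icc (0:ℝ) 1 ∧ c - τ ∈ Icc (0:ℝ) 1 ∧
      2 * q c < q (c + τ) + q (c - τ)) : ∀ t ∈ Icc (0:ℝ) 1, q t ≤ 0 := by
  intro t ht
  obtain ⟨c, hc, hmax⟩ := isCompact_Icc.exists_isMaxOn ⟨t, ht⟩ hq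
  by_contra! hpos
  have hm : ∀ u ∈ Icc (0:ℝ) 1, q u ≤ q c := fun u hu => hmax hu
  have hct := hm t ht
  have hc0 : c ≠ 0 := by rintro rfl; linarith
  have hc1 : c ≠ 1 := by rintro rfl; linarith
  obtain ⟨τ, hp, hn, hlt⟩ := H c ⟨lt_of_le_of_ne hc.1 (Ne.symm hc0), lt_of_le_of_ne hc.2 hc1⟩
  linarith [hm _ hp, hm _ hn]

theorem aux_subgrad {E : Type*} [NormedAddCommGroup E] [InnerProductSpace ℝ E]
    [FiniteDimensional ℝ E] {D : Set E} {h : E → ℝ} (hc : ConvexOn ℝ D h) {x : E}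
    (hx : x ∈ interior D) : ∃ s : E, ∀ u ∈ D, h x + ⟪s, u - x⟫ ≤ h u := by
  have hcI : ConvexOn ℝ (interior D) h := hc.subset interior_subset hc.1.interior
  have hcont := hc.continuousOn_interior
  have hS := hcI.convex_strict_epigraph
  have hO : IsOpen {p : E × ℝ | p.1 ∈ interior D ∧ h p.1 < p.2} := by
    rw [isOpen_iff_mem_nhds]
    rintro ⟨v, r⟩ ⟨hv, hr⟩
    have hca : ContinuousAt h v := hcont.continuousAt (isOpen_interior.mem_nhds hv)
    have hca1 : ContinuousAt (fun p : E × ℝ => h p.1) (v, r) :=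
      ContinuousAt.comp (f := fun p : E × ℝ => p.1) (x := (v, r)) hca continuousAt_fst
    have e1 : ∀ᶠ p : E × ℝ in 𝓝 (v, r), h p.1 < p.2 :=
      hca1.eventually_lt continuousAt_snd hr
    have e2 : ∀ᶠ p : E × ℝ in 𝓝 (v, r), p.1 ∈ interior D :=
      continuousAt_fst.eventually (isOpen_interior.mem_nhds hv)
    filter_upwards [e1, e2] with p h1 h2 using ⟨h2, h1⟩
  obtain ⟨f, hf⟩ := geometric_hahn_banach_open_point (x := (x, h x)) hS hO (by simp)
  set g : E →L[ℝ] ℝ := f.comp (ContinuousLinearMap.inl ℝ E ℝ) with hg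
  set c : ℝ := f (0, 1) with hcdef
  have hfe : ∀ v r, f (v, r) = g v + c * r := by
    intro v r
    have : ((v, r) : E × ℝ) = (v, 0) + r • ((0 : E), (1 : ℝ)) := by simp
    rw [this, map_add, map_smul, smul_eq_mul, mul_comm]
    rfl
  have hcneg : c < 0 := by
    have := hf (x, h x + 1) ⟨hx, by simp⟩
    rw [hfe, hfe] at this
    linarith
  have key : ∀ v ∈ interior D, g v + c * h v ≤ g x + c * h x := by
    intro v hv
    apply le_of_forall_pos_lt_add
    intro ε hε
    have := hf (v, h v + ε / (-c)) ⟨hv, by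
      have : 0 < ε / (-c) := div_pos hε (by linarith)
      simpa using this⟩
    rw [hfe, hfe] at this
    have e : c * (ε / (-c)) = - ε := by
      rw [div_neg, mul_neg, mul_div_cancel₀ _ hcneg.ne]
    nlinarith
  refine ⟨(InnerProductSpace.toDual ℝ E).symm ((-c)⁻¹ • g), fun u hu => ?_⟩
  rw [InnerProductSpace.toDual_symm_apply]
  have hm := hc.1.combo_interior_self_mem_interior hx hu (a := 1/2) (b := 1/2)
    (by norm_num) (by norm_num) (by norm_num)
  have h1 := key _ hm
  have h2 := hc.2 (interior_subset hx) hu (show (0:ℝ) ≤ 1/2 by norm_num)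
    (show (0:ℝ) ≤ 1/2 by norm_num) (by norm_num)
  simp only [map_add, map_smul, smul_eq_mul] at h1 h2
  have h3 : g u - g x ≤ (-c) * (h u - h x) := by nlinarith
  have h4 : (-c)⁻¹ * (g u - g x) ≤ h u - h x := by
    rw [inv_mul_le_iff₀ (by linarith)]; exact h3
  simp only [smul_apply, map_sub, smul_eq_mul]
  linarith

theorem aux_norm {E : Type*} [NormedAddCommGroup E] [InnerProductSpace ℝ E] (x y : E) (a b : ℝ)
    (hab : a + b = 1) :
    ‖a • x + b • y‖ ^ 2 = a * ‖x‖ ^ 2 + b * ‖y‖ ^ 2 - a * b * ‖x - y‖ ^ 2 := by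
  rw [norm_add_sq_real, norm_sub_sq_real, norm_smul, norm_smul, inner_smul_left, inner_smul_right,
    mul_pow, mul_pow, Real.norm_eq_abs, Real.norm_eq_abs, sq_abs, sq_abs]
  obtain rfl : b = 1 - a := by linarith
  simp
  ring

theorem aux_local {E : Type*} [NormedAddCommGroup E] [InnerProductSpace ℝ E]
    [FiniteDimensional ℝ E] {D : Set E} {h : E → ℝ} (hc : ConvexOn ℝ D h) (μ : ℝ)
    (H : ∀ x ∈ interior D, ∀ s : E, (∀ u ∈ D, h x + ⟪s, u - x⟫ ≤ h u) → ∀ w : E, w ≠ 0 →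
      ∀ μ' < μ, ∀ᶠ τ : ℝ in 𝓝[>] 0, x + τ • w ∈ D →
        h x + τ * ⟪s, w⟫ + μ' / 2 * τ ^ 2 * ‖w‖ ^ 2 < h (x + τ • w))
    {x y : E} (hx : x ∈ interior D) (hy : y ∈ interior D) {a b : ℝ} (ha : 0 ≤ a) (hb : 0 ≤ b)
    (hab : a + b = 1) :
    h (a • x + b • y) ≤ a * h x + b * h y - a * b * (μ / 2) * ‖x - y‖ ^ 2 := by
  obtain rfl | hxy := eq_or_ne x y
  · rw [← add_smul, hab]; simp [← add_mul, hab]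
  obtain rfl : a = 1 - b := by linarith
  have hw : y - x ≠ 0 := sub_ne_zero.2 hxy.symm
  set w := y - x with hwdef
  have hline : ∀ t : ℝ, (1 - t) • x + t • y = x + t • w := by
    intro t; rw [hwdef]; module
  have hnw : ‖x - y‖ = ‖w‖ := norm_sub_rev _ _
  have hmem : ∀ t ∈ Icc (0:ℝ) 1, x + t • w ∈ interior D := by
    intro t ht
    rw [← hline]
    exact hc.1.interior hx hy (by linarith [ht.2]) ht.1 (by ring)
  have step : ∀ μ' < μ, h (x + b • w) ≤
      (1 - b) * h x + b * h y - (1 - b) * b * (μ' / 2) * ‖w‖ ^ 2 := by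
    intro μ' hμ'
    have := aux_max (fun t => h (x + t • w) - (1 - t) * h x - t * h y
      + (1 - t) * t * (μ' / 2) * ‖w‖ ^ 2) ?_ (by simp) ?_ ?_ b ⟨hb, by linarith⟩
    · linarith
    · have h1 : ContinuousOn (fun t : ℝ => h (x + t • w)) (Icc 0 1) :=
        hc.continuousOn_interior.comp (by fun_prop) hmem
      have h2 : Continuous (fun t : ℝ => - (1 - t) * h x - t * h y
        + (1 - t) * t * (μ' / 2) * ‖w‖ ^ 2) := by fun_prop
      refine (h1.add h2.continuousOn).congr fun t _ => ?_
      simp only [Pi.add_apply]; ring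
    · simp [hwdef]
    · intro c hcc
      have hcD := hmem c ⟨hcc.1.le, hcc.2.le⟩
      obtain ⟨s, hs⟩ := aux_subgrad hc hcD
      have e1 := H _ hcD s hs w hw μ' hμ'
      have e2 := H _ hcD s hs (-w) (neg_ne_zero.2 hw) μ' hμ'
      have e3 : ∀ᶠ τ : ℝ in 𝓝[>] 0, τ < min c (1 - c) :=
        nhdsWithin_le_nhds (gt_mem_nhds (lt_min hcc.1 (by linarith [hcc.2])))
      obtain ⟨τ, h1, h2, h3, h4⟩ := (e1.and (e2.and (e3.and self_mem_nhdsWithin))).exists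
      have h4 : 0 < τ := h4
      have h5 := h3.trans_le (min_le_left _ _)
      have h6 := h3.trans_le (min_le_right _ _)
      have m1 : c + τ ∈ Icc (0:ℝ) 1 := ⟨by linarith [hcc.1], by linarith⟩
      have m2 : c - τ ∈ Icc (0:ℝ) 1 := ⟨by linarith, by linarith [hcc.2]⟩
      have r1 : x + c • w + τ • w = x + (c + τ) • w := by module
      have r2 : x + c • w + τ • (-w) = x + (c - τ) • w := by module
      rw [r1] at h1
      rw [r2, inner_neg_right, norm_neg] at h2
      have h1 := h1 (interior_subset (hmem _ m1))
      have h2 := h2 (interior_subset (hmem _ m2))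
      refine ⟨τ, m1, m2, ?_⟩
      nlinarith
  rw [hline, hnw]
  have hcl : Tendsto (fun μ' : ℝ => (1 - b) * h x + b * h y - (1 - b) * b * (μ' / 2) * ‖w‖ ^ 2)
      (𝓝[<] μ) (𝓝 ((1 - b) * h x + b * h y - (1 - b) * b * (μ / 2) * ‖w‖ ^ 2)) := by
    apply Tendsto.mono_left _ nhdsWithin_le_nhds
    apply Continuous.tendsto
    fun_prop
  exact ge_of_tendsto hcl (by filter_upwards [self_mem_nhdsWithin] with μ' hμ' using step μ' hμ')

theorem aux_conv_iff {m : ℕ} (φ : EuclideanSpace ℝ (Fin m) → EReal)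
    (hnotbot : ∀ x, φ x ≠ ⊥) (c : ℝ) :
    ERealConvex (shiftFun c φ) ↔ ∀ x y : EuclideanSpace ℝ (Fin m), φ x ≠ ⊤ → φ y ≠ ⊤ →
      ∀ a b : ℝ, 0 ≤ a → 0 ≤ b → a + b = 1 →
      φ (a • x + b • y) ≤ ((a * (φ x).toReal + b * (φ y).toReal
        + a * b * (c / 2) * ‖x - y‖ ^ 2 : ℝ) : EReal) := by
  have core : ∀ x y : EuclideanSpace ℝ (Fin m), φ x ≠ ⊤ → φ y ≠ ⊤ →
      ∀ a b : ℝ, a + b = 1 →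
      (φ (a • x + b • y) ≤ ((a * (φ x).toReal + b * (φ y).toReal
        + a * b * (c / 2) * ‖x - y‖ ^ 2 : ℝ) : EReal) ↔
        shiftFun c φ (a • x + b • y) ≤ (a : EReal) * shiftFun c φ x + (b : EReal) * shiftFun c φ y)
      := by
    intro x y hx hy a b hab
    have e1 : φ x = ((φ x).toReal : EReal) := (EReal.coe_toReal hx (hnotbot x)).symm
    have e2 : φ y = ((φ y).toReal : EReal) := (EReal.coe_toReal hy (hnotbot y)).symm
    unfold shiftFun
    rw [e1, e2]
    by_cases hz : φ (a • x + b • y) = ⊤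
    · rw [hz, EReal.top_add_coe]
      norm_cast
      simp only [EReal.toReal_coe, top_le_iff, EReal.coe_ne_top]
    · have e3 : φ (a • x + b • y) = ((φ (a • x + b • y)).toReal : EReal) :=
        (EReal.coe_toReal hz (hnotbot _)).symm
      rw [e3, aux_norm x y a b hab]
      norm_cast
      simp only [EReal.toReal_coe]
      constructor <;> intro h <;> nlinarith
  constructor
  · intro h x y hx hy a b ha hb hab
    exact (core x y hx hy a b hab).2 (h x y a b ha hb hab)
  · intro h x y a b ha hb hab
    have hnb : ∀ z, shiftFun c φ z ≠ ⊥ := by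
      intro z
      unfold shiftFun
      rw [Ne, EReal.add_eq_bot_iff]
      simp only [hnotbot z, EReal.coe_ne_bot, or_self, not_false_eq_true]
    obtain rfl | ha' := ha.eq_or_lt
    · obtain rfl : b = 1 := by linarith
      simp
    obtain rfl | hb' := hb.eq_or_lt
    · obtain rfl : a = 1 := by linarith
      simp
    have mulnb : ∀ (r : ℝ) z, 0 < r → (r : EReal) * shiftFun c φ z ≠ ⊥ := by
      intro r z hr
      rw [Ne, EReal.mul_eq_bot]
      simp [hnb z, hr.not_gt, EReal.coe_ne_bot]
    by_cases hx : φ x = ⊤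
    · have : shiftFun c φ x = ⊤ := by unfold shiftFun; rw [hx, EReal.top_add_coe]
      rw [this, EReal.coe_mul_top_of_pos ha', EReal.top_add_of_ne_bot (mulnb b y hb')]
      exact le_top
    by_cases hy : φ y = ⊤
    · have : shiftFun c φ y = ⊤ := by unfold shiftFun; rw [hy, EReal.top_add_coe]
      rw [this, EReal.coe_mul_top_of_pos hb', EReal.add_top_of_ne_bot (mulnb a x ha')]
      exact le_top
    exact (core x y hx hy a b hab).1 (h x y hx hy a b ha hb hab)

theorem aux_delta_real {m : ℕ} (φ : EuclideanSpace ℝ (Fin m) → EReal)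
    (hnotbot : ∀ x, φ x ≠ ⊥) (x v u : EuclideanSpace ℝ (Fin m)) (τ : ℝ)
    (hx : φ x ≠ ⊤) (hu : φ (x + τ • u) ≠ ⊤) :
    delta2 φ x v τ u = ((2 / τ ^ 2 * ((φ (x + τ • u)).toReal - (φ x).toReal - τ * ⟪v, u⟫) : ℝ) :
      EReal) := by
  unfold delta2
  nth_rewrite 1 [← EReal.coe_toReal hx (hnotbot x), ← EReal.coe_toReal hu (hnotbot _)]
  norm_cast

theorem aux_forward {m : ℕ} (φ : EuclideanSpace ℝ (Fin m) → EReal)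
    (hnotbot : ∀ x, φ x ≠ ⊥) (ρ κ : ℝ) (hs : ERealConvex (shiftFun (-κ) φ))
    (x v : EuclideanSpace ℝ (Fin m)) (hxv : (x, v) ∈ gphSubdiff ρ φ)
    (w : EuclideanSpace ℝ (Fin m)) :
    ((κ * ‖w‖ ^ 2 : ℝ) : EReal) ≤ secondSubderiv φ x v w := by
  obtain ⟨hx, hv⟩ := hxv
  simp only at hx hv
  rw [aux_conv_iff φ hnotbot] at hs
  have grow : ∀ u, φ u ≠ ⊤ →
      (φ x).toReal + ⟪v, u - x⟫ + κ / 2 * ‖u - x‖ ^ 2 ≤ (φ u).toReal := by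
    intro u hu
    have step : ∀ t ∈ Ioo (0:ℝ) 1, (φ x).toReal + ⟪v, u - x⟫ + κ / 2 * (1 - t) * ‖u - x‖ ^ 2
        - ρ / 2 * t * ‖u - x‖ ^ 2 ≤ (φ u).toReal := by
      intro t ht
      have h1 := hs x u hx hu (1 - t) t (by linarith [ht.2]) ht.1.le (by ring)
      have h2 := (hv ((1 - t) • x + t • u)).trans h1
      have e : (1 - t) • x + t • u - x = t • (u - x) := by module
      rw [e, ← EReal.coe_toReal hx (hnotbot x), inner_smul_right, norm_smul, mul_pow,
        Real.norm_eq_abs, sq_abs, norm_sub_rev x u] at h2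
      norm_cast at h2
      simp only [EReal.toReal_coe] at h2
      have h3 : t * ((φ x).toReal + ⟪v, u - x⟫ + κ / 2 * (1 - t) * ‖u - x‖ ^ 2
        - ρ / 2 * t * ‖u - x‖ ^ 2) ≤ t * (φ u).toReal := by linarith
      exact le_of_mul_le_mul_left h3 ht.1
    have hcl : Tendsto (fun t : ℝ => (φ x).toReal + ⟪v, u - x⟫ + κ / 2 * (1 - t) * ‖u - x‖ ^ 2
        - ρ / 2 * t * ‖u - x‖ ^ 2) (𝓝[>] 0)
        (𝓝 ((φ x).toReal + ⟪v, u - x⟫ + κ / 2 * (1 - 0) * ‖u - x‖ ^ 2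
        - ρ / 2 * 0 * ‖u - x‖ ^ 2)) := by
      apply Tendsto.mono_left _ nhdsWithin_le_nhds
      apply Continuous.tendsto
        (f := fun t : ℝ => (φ x).toReal + ⟪v, u - x⟫ + κ / 2 * (1 - t) * ‖u - x‖ ^ 2
        - ρ / 2 * t * ‖u - x‖ ^ 2)
      fun_prop
    have := le_of_tendsto hcl (by
      filter_upwards [Ioo_mem_nhdsGT (zero_lt_one' ℝ)] with t ht using step t ht)
    linarith
  have ht : Tendsto (fun p : ℝ × EuclideanSpace ℝ (Fin m) => ((κ * ‖p.2‖ ^ 2 : ℝ) : EReal))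
      ((𝓝[>] (0 : ℝ)) ×ˢ 𝓝 w) (𝓝 ((κ * ‖w‖ ^ 2 : ℝ) : EReal)) := by
    have c1 : Continuous (fun u : EuclideanSpace ℝ (Fin m) => ((κ * ‖u‖ ^ 2 : ℝ) : EReal)) :=
      continuous_coe_real_ereal.comp (by fun_prop)
    exact (c1.tendsto w).comp tendsto_snd
  rw [← ht.liminf_eq]
  unfold secondSubderiv
  refine liminf_le_liminf ?_
  have hp : ∀ᶠ p : ℝ × EuclideanSpace ℝ (Fin m) in (𝓝[>] (0 : ℝ)) ×ˢ 𝓝 w, 0 < p.1 :=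
    tendsto_fst.eventually self_mem_nhdsWithin
  filter_upwards [hp] with p hp
  obtain ⟨τ, u⟩ := p
  simp only at hp ⊢
  by_cases hu : φ (x + τ • u) = ⊤
  · unfold delta2
    rw [hu, ← EReal.coe_toReal hx (hnotbot x), EReal.top_sub_coe, EReal.top_sub_coe,
      EReal.coe_mul_top_of_pos (by positivity)]
    exact le_top
  · rw [aux_delta_real φ hnotbot x v u τ hx hu, EReal.coe_le_coe_iff]
    have := grow _ hu
    rw [add_sub_cancel_left, inner_smul_right, norm_smul, mul_pow,
        Real.norm_eq_abs, sq_abs] at this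
    rw [div_mul_eq_mul_div, le_div_iff₀ (by positivity)]
    linarith

theorem aux_backward {m : ℕ} (φ : EuclideanSpace ℝ (Fin m) → EReal)
    (hnotbot : ∀ x, φ x ≠ ⊥) (hproper : ∃ x, φ x ≠ ⊤)
    (hlsc : LowerSemicontinuous φ) (ρ κ : ℝ) (hweak : ERealConvex (shiftFun ρ φ))
    (H : ∀ x v : EuclideanSpace ℝ (Fin m), (x, v) ∈ gphSubdiff ρ φ →
        ∀ w : EuclideanSpace ℝ (Fin m),
          ((κ * ‖w‖ ^ 2 : ℝ) : EReal) ≤ secondSubderiv φ x v w) :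
    ERealConvex (shiftFun (-κ) φ) := by
  obtain ⟨x₀, hx₀⟩ := hproper
  rw [aux_conv_iff φ hnotbot] at hweak ⊢
  set S : Set (EuclideanSpace ℝ (Fin m)) := {y | φ (x₀ + y) ≠ ⊤} with hS
  set V := Submodule.span ℝ S with hV
  set D : Set V := ((↑) : V → EuclideanSpace ℝ (Fin m)) ⁻¹' S with hD
  set h : V → ℝ := fun z => (φ (x₀ + z)).toReal + ρ / 2 * ‖x₀ + (z : EuclideanSpace ℝ (Fin m))‖ ^ 2
    with hh
  have hcomb : ∀ (x y : V) (a b : ℝ), a + b = 1 →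
      x₀ + ((a • x + b • y : V) : EuclideanSpace ℝ (Fin m)) = a • (x₀ + x) + b • (x₀ + y) := by
    intro x y a b hab
    obtain rfl : b = 1 - a := by linarith
    push_cast
    module
  have hweakD : ∀ (x y : V) (a b : ℝ), x ∈ D → y ∈ D → 0 ≤ a → 0 ≤ b → a + b = 1 →
      a • x + b • y ∈ D ∧ h (a • x + b • y) ≤ a * h x + b * h y := by
    intro x y a b hx hy ha hb hab
    have h1 := hweak _ _ hx hy a b ha hb hab
    have h2 : φ (x₀ + ((a • x + b • y : V) : EuclideanSpace ℝ (Fin m))) ≠ ⊤ := by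
      rw [hcomb _ _ _ _ hab]
      exact ne_top_of_le_ne_top (EReal.coe_ne_top _) h1
    refine ⟨h2, ?_⟩
    rw [hcomb _ _ _ _ hab] at h2
    rw [← EReal.coe_toReal h2 (hnotbot _), EReal.coe_le_coe_iff] at h1
    simp only [hh]
    rw [hcomb _ _ _ _ hab, aux_norm _ _ _ _ hab]
    linarith
  have hconv : ConvexOn ℝ D h :=
    ⟨fun x hx y hy a b ha hb hab => (hweakD x y a b hx hy ha hb hab).1,
      fun x hx y hy a b ha hb hab => (hweakD x y a b hx hy ha hb hab).2⟩
  have h0 : (0 : V) ∈ D := by simpa [hD, hS] using hx₀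
  have hInt : (interior D).Nonempty := by
    rw [hconv.1.interior_nonempty_iff_affineSpan_eq_top,
      AffineSubspace.affineSpan_eq_top_iff_vectorSpan_eq_top_of_nonempty _ _ _ ⟨0, h0⟩,
      vectorSpan_eq_span_vsub_set_right ℝ h0]
    have key : Submodule.span ℝ D = ⊤ := Submodule.span_span_coe_preimage (R := ℝ) (s := S)
    simpa using key
  obtain ⟨z₀, hz₀⟩ := hInt

  have hVmem : ∀ u, φ u ≠ ⊤ → ∃ z : V, z ∈ D ∧ u = x₀ + z := by
    intro u hu
    have hu' : u - x₀ ∈ S := by simpa [hS] using hu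
    exact ⟨⟨u - x₀, Submodule.subset_span hu'⟩, hu', by simp⟩
  have hloc : ∀ x ∈ interior D, ∀ s : V, (∀ u ∈ D, h x + ⟪s, u - x⟫ ≤ h u) → ∀ w : V, w ≠ 0 →
      ∀ μ' < κ + ρ, ∀ᶠ τ : ℝ in 𝓝[>] 0, x + τ • w ∈ D →
        h x + τ * ⟪s, w⟫ + μ' / 2 * τ ^ 2 * ‖w‖ ^ 2 < h (x + τ • w) := by
    intro x hx s hs w hw μ' hμ'
    have hxD : φ (x₀ + x) ≠ ⊤ := interior_subset hx
    have hsub : (x₀ + (x : EuclideanSpace ℝ (Fin m)),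
        (s : EuclideanSpace ℝ (Fin m)) - ρ • (x₀ + x)) ∈ gphSubdiff ρ φ := by
      refine ⟨hxD, fun u => ?_⟩
      simp only
      by_cases hu : φ u = ⊤
      · rw [hu]; exact le_top
      obtain ⟨z, hz, rfl⟩ := hVmem u hu
      have h1 := hs z hz
      simp only [hh] at h1
      rw [Submodule.coe_inner, Submodule.coe_sub] at h1
      rw [← EReal.coe_toReal hxD (hnotbot _), ← EReal.coe_toReal hu (hnotbot _),
        ← EReal.coe_add, EReal.coe_le_coe_iff]
      have e : x₀ + (z : EuclideanSpace ℝ (Fin m)) - (x₀ + x) = z - x := by abel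
      have e2 : x₀ + (z : EuclideanSpace ℝ (Fin m)) = (x₀ + x) + (z - x) := by abel
      have e3 : ‖x₀ + (z : EuclideanSpace ℝ (Fin m))‖ ^ 2 = ‖x₀ + (x : EuclideanSpace ℝ (Fin m))‖ ^ 2
        + 2 * ⟪x₀ + (x : EuclideanSpace ℝ (Fin m)), (z - x : EuclideanSpace ℝ (Fin m))⟫
        + ‖(z - x : EuclideanSpace ℝ (Fin m))‖ ^ 2 := by rw [e2, norm_add_sq_real]
      rw [e3] at h1
      rw [e, inner_sub_left, real_inner_smul_left]
      linarith
    have h2 := H _ _ hsub w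
    have hwpos : 0 < ‖(w : EuclideanSpace ℝ (Fin m))‖ ^ 2 := by
      have : 0 < ‖w‖ := norm_pos_iff.2 hw
      rw [← Submodule.coe_norm]; positivity
    have h3 : (((μ' - ρ) * ‖(w : EuclideanSpace ℝ (Fin m))‖ ^ 2 : ℝ) : EReal) <
        ((κ * ‖(w : EuclideanSpace ℝ (Fin m))‖ ^ 2 : ℝ) : EReal) := by
      rw [EReal.coe_lt_coe_iff]
      exact mul_lt_mul_of_pos_right (by linarith) hwpos
    have h4 := eventually_lt_of_lt_liminf (h3.trans_le h2)
    have ht : Tendsto (fun τ : ℝ => (τ, (w : EuclideanSpace ℝ (Fin m)))) (𝓝[>] 0)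
        ((𝓝[>] (0 : ℝ)) ×ˢ 𝓝 (w : EuclideanSpace ℝ (Fin m))) :=
      tendsto_id.prodMk tendsto_const_nhds
    filter_upwards [ht.eventually h4, self_mem_nhdsWithin] with τ hτ hpos hmem
    have hpos : 0 < τ := hpos
    have e : x₀ + ((x + τ • w : V) : EuclideanSpace ℝ (Fin m)) = x₀ + x + τ • (w : EuclideanSpace ℝ (Fin m)) := by
      push_cast; abel
    have hm : φ (x₀ + x + τ • (w : EuclideanSpace ℝ (Fin m))) ≠ ⊤ := by
      rw [← e]; exact hmem
    rw [aux_delta_real φ hnotbot _ _ _ _ hxD hm, EReal.coe_lt_coe_iff, div_mul_eq_mul_div,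
      lt_div_iff₀ (by positivity), inner_sub_left, real_inner_smul_left] at hτ
    simp only [hh]
    rw [e, norm_add_sq_real (x₀ + (x : EuclideanSpace ℝ (Fin m))), Submodule.coe_inner, norm_smul,
      inner_smul_right, mul_pow, Real.norm_eq_abs, sq_abs, Submodule.coe_norm]
    linarith
  intro x' y' hx' hy' a b ha hb hab
  obtain ⟨x, hx, rfl⟩ := hVmem x' hx'
  obtain ⟨y, hy, rfl⟩ := hVmem y' hy'
  set z : ℝ → V := fun t => a • (t • z₀ + (1 - t) • x) + b • (t • z₀ + (1 - t) • y) with hz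
  set R : ℝ → ℝ := fun t => a * (t * h z₀ + (1 - t) * h x) + b * (t * h z₀ + (1 - t) * h y)
    - a * b * ((κ + ρ) / 2) * ((1 - t) ^ 2 * ‖x - y‖ ^ 2)
    - ρ / 2 * ‖x₀ + (z t : EuclideanSpace ℝ (Fin m))‖ ^ 2 with hR
  have hzc : Continuous (fun t => x₀ + (z t : EuclideanSpace ℝ (Fin m))) := by
    simp only [hz]; fun_prop
  have hRc : Continuous R := by
    simp only [hR]; fun_prop
  have hz0 : x₀ + (z 0 : EuclideanSpace ℝ (Fin m)) = a • (x₀ + x) + b • (x₀ + y) := by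
    rw [← hcomb _ _ _ _ hab]; simp [hz]
  have hRt : ∀ t ∈ Ioo (0:ℝ) 1, φ (x₀ + z t) ≤ (R t : EReal) := by
    intro t ht
    have mx := hconv.1.combo_interior_self_mem_interior hz₀ hx ht.1
      (by linarith [ht.2] : 0 ≤ 1 - t) (by ring)
    have my := hconv.1.combo_interior_self_mem_interior hz₀ hy ht.1
      (by linarith [ht.2] : 0 ≤ 1 - t) (by ring)
    have h1 := aux_local hconv (κ + ρ) hloc mx my ha hb hab
    have h2 := (hweakD z₀ x t (1 - t) (interior_subset hz₀) hx ht.1.le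
      (by linarith [ht.2]) (by ring)).2
    have h3 := (hweakD z₀ y t (1 - t) (interior_subset hz₀) hy ht.1.le
      (by linarith [ht.2]) (by ring)).2
    have hzD : φ (x₀ + z t) ≠ ⊤ :=
      (hweakD _ _ a b (interior_subset mx) (interior_subset my) ha hb hab).1
    have e : (t • z₀ + (1 - t) • x) - (t • z₀ + (1 - t) • y) = (1 - t) • (x - y) := by module
    rw [e, norm_smul, mul_pow, Real.norm_eq_abs, sq_abs] at h1
    have h4 : h (z t) = (φ (x₀ + z t)).toReal + ρ / 2 * ‖x₀ + (z t : EuclideanSpace ℝ (Fin m))‖ ^ 2 := rfl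
    change h (z t) ≤ _ at h1
    rw [h4] at h1
    rw [← EReal.coe_toReal hzD (hnotbot _), EReal.coe_le_coe_iff]
    simp only [hR]
    have h5 := mul_le_mul_of_nonneg_left h2 ha
    have h6 := mul_le_mul_of_nonneg_left h3 hb
    linarith
  have hfin : φ (a • (x₀ + x) + b • (x₀ + y)) ≤ (R 0 : EReal) := by
    rw [← hz0]
    apply le_of_forall_lt
    intro c hc
    obtain ⟨c', hcc', hc'⟩ := exists_between hc
    refine hcc'.trans_le ?_
    have e1 : ∀ᶠ t in 𝓝 (0:ℝ), c' < φ (x₀ + z t) :=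
      (hzc.tendsto 0).eventually (hlsc _ c' hc')
    have hRE : Tendsto (fun t => (R t : EReal)) (𝓝[>] 0) (𝓝 (R 0 : EReal)) :=
      ((continuous_coe_real_ereal.comp hRc).tendsto 0).mono_left nhdsWithin_le_nhds
    refine ge_of_tendsto hRE ?_
    filter_upwards [nhdsWithin_le_nhds e1, Ioo_mem_nhdsGT (zero_lt_one' ℝ)] with t h1 h2
    exact h1.le.trans (hRt t h2)
  refine hfin.trans ?_
  rw [EReal.coe_le_coe_iff]
  simp only [hR, hz0]
  rw [aux_norm _ _ _ _ hab]
  simp only [hh]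
  rw [add_sub_add_left_eq_sub, ← Submodule.coe_sub, ← Submodule.coe_norm]
  apply le_of_eq
  ring

/-- strong convexity of a weakly convex function characterized via
second subderivatives. -/
theorem statement11 (n : ℕ) (φ : EuclideanSpace ℝ (Fin n) → EReal)
    (hnotbot : ∀ x, φ x ≠ ⊥) (hproper : ∃ x, φ x ≠ ⊤)
    (hlsc : LowerSemicontinuous φ)
    (ρ : ℝ) (hρ : 0 ≤ ρ) (hweak : ERealConvex (shiftFun ρ φ)) (κ : ℝ) (hκ : 0 < κ) :
    ERealConvex (shiftFun (-κ) φ) ↔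
      ∀ x v : EuclideanSpace ℝ (Fin n), (x, v) ∈ gphSubdiff ρ φ →
        ∀ w : EuclideanSpace ℝ (Fin n),
          ((κ * ‖w‖ ^ 2 : ℝ) : EReal) ≤ secondSubderiv φ x v w := by
  constructor
  · intro hs x v hxv w
    exact aux_forward φ hnotbot ρ κ hs x v hxv w
  · exact aux_backward φ hnotbot hproper hlsc ρ κ hweak

end
end

section
/- Let φ : ℝⁿ → ℝ ∪ {+∞} be proper and lower semicontinuous. Then φ is convex if and only if there exists ρ ≥ 0 such that φ is ρ-weakly convex and, for every (x,y) ∈ gph ∂φ and every w, z ∈ ℝⁿ with (z, −w) ∈ N̂_{gph ∂φ}(x,y), one has ⟨z,w⟩ ≥ 0. -/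
open scoped RealInnerProductSpace
open Filter Topology MeasureTheory Set

noncomputable section

variable {n : ℕ}

variable {φ : EuclideanSpace ℝ (Fin n) → EReal}

lemma coe_toR (hb : ∀ x, φ x ≠ ⊥) {x} (hx : φ x ≠ ⊤) : φ x = (((φ x).toReal : ℝ) : EReal) :=
  (EReal.coe_toReal hx (hb x)).symm

/-- lower semicontinuity of a sum with a continuous real function -/
lemma lsc_add_cont {X : Type*} [TopologicalSpace X] {F : X → EReal} (hF : LowerSemicontinuous F)
    {f : X → ℝ} (hf : Continuous f) : LowerSemicontinuous (fun x => F x + ((f x : ℝ) : EReal)) := by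
  refine LowerSemicontinuous.add' hF
    (continuous_coe_real_ereal.comp hf).lowerSemicontinuous ?_
  intro x
  exact EReal.continuousAt_add (Or.inr (EReal.coe_ne_bot _)) (Or.inr (EReal.coe_ne_top _))

lemma weak_conv (hb : ∀ x, φ x ≠ ⊥) {ρ : ℝ} (hc : ERealConvex (shiftFun ρ φ))
    {x y : EuclideanSpace ℝ (Fin n)} (hx : φ x ≠ ⊤) (hy : φ y ≠ ⊤) {a b : ℝ} (ha : 0 ≤ a)
    (hb' : 0 ≤ b) (hab : a + b = 1) :
    φ (a • x + b • y) ≠ ⊤ ∧ (φ (a • x + b • y)).toReal ≤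
      a * (φ x).toReal + b * (φ y).toReal + ρ / 2 * (a * b * ‖x - y‖ ^ 2) := by
  have h := hc x y a b ha hb' hab
  simp only [shiftFun] at h
  have e1 := coe_toR hb hx
  have e2 := coe_toR hb hy
  generalize (φ x).toReal = X at *
  generalize (φ y).toReal = Y at *
  rw [e1, e2] at h
  norm_cast at h
  have hne : φ (a • x + b • y) ≠ ⊤ := by
    intro ht
    rw [ht, EReal.top_add_coe] at h
    exact absurd h (not_le.2 (EReal.coe_lt_top _))
  refine ⟨hne, ?_⟩
  rw [coe_toR hb hne] at h
  norm_cast at h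
  have : ‖a • x + b • y‖ ^ 2 = a * ‖x‖ ^ 2 + b * ‖y‖ ^ 2 - a * b * ‖x - y‖ ^ 2 := by
    rw [norm_add_sq_real, norm_sub_sq_real, norm_smul, norm_smul, real_inner_smul_left,
      real_inner_smul_right, mul_pow, mul_pow, Real.norm_eq_abs, Real.norm_eq_abs, sq_abs, sq_abs]
    have : b = 1 - a := by linarith
    subst this; ring
  rw [this] at h
  linarith

lemma mem_gph (hb : ∀ x, φ x ≠ ⊥) {ρ : ℝ} {x v : EuclideanSpace ℝ (Fin n)} :
    (x, v) ∈ gphSubdiff ρ φ ↔ φ x ≠ ⊤ ∧ ∀ u, φ u ≠ ⊤ →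
      (φ x).toReal + (⟪v, u - x⟫ - (ρ / 2) * ‖u - x‖ ^ 2) ≤ (φ u).toReal := by
  simp only [gphSubdiff, subdiff, mem_ofPred_eq]
  refine and_congr_right fun hx => forall_congr' fun u => ?_
  by_cases hu : φ u = ⊤
  · simp [hu]
  · rw [coe_toR hb hx, coe_toR hb hu]
    simp only [EReal.toReal_coe, ne_eq, EReal.coe_ne_top, not_false_eq_true, forall_const]
    norm_cast

lemma exists_min_compact (hb : ∀ x, φ x ≠ ⊥) (hl : LowerSemicontinuous φ)
    {K : Set (EuclideanSpace ℝ (Fin n))} (hK : IsCompact K) {x₀ : EuclideanSpace ℝ (Fin n)}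
    (hx₀ : φ x₀ ≠ ⊤) (hxK : x₀ ∈ K) {f : EuclideanSpace ℝ (Fin n) → ℝ} (hf : Continuous f) :
    ∃ m ∈ K, φ m ≠ ⊤ ∧ ∀ u ∈ K, φ u ≠ ⊤ → (φ m).toReal + f m ≤ (φ u).toReal + f u := by
  obtain ⟨m, hm, hmin⟩ := ((lsc_add_cont hl hf).lowerSemicontinuousOn K).exists_isMinOn
    ⟨x₀, hxK⟩ hK
  have hmt : φ m ≠ ⊤ := by
    intro ht
    have := hmin hxK
    simp only [mem_ofPred_eq] at this
    rw [ht, EReal.top_add_coe, coe_toR hb hx₀] at this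
    norm_cast at this
  refine ⟨m, hm, hmt, fun u hu hut => ?_⟩
  have := hmin hu
  simp only [mem_ofPred_eq] at this
  rw [coe_toR hb hmt, coe_toR hb hut] at this
  norm_cast at this

lemma exists_min_s12 (hb : ∀ x, φ x ≠ ⊥) (hl : LowerSemicontinuous φ)
    {x₀ : EuclideanSpace ℝ (Fin n)}
    (hx₀ : φ x₀ ≠ ⊤) {f : EuclideanSpace ℝ (Fin n) → ℝ} (hf : Continuous f)
    (c : EuclideanSpace ℝ (Fin n)) (R : ℝ)
    (h : ∀ u, φ u ≠ ⊤ → R < ‖u - c‖ → (φ x₀).toReal + f x₀ ≤ (φ u).toReal + f u) :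
    ∃ m, φ m ≠ ⊤ ∧ ∀ u, φ u ≠ ⊤ → (φ m).toReal + f m ≤ (φ u).toReal + f u := by
  have hx : x₀ ∈ Metric.closedBall c (max R ‖x₀ - c‖) := by
    simp [dist_eq_norm]
  obtain ⟨m, -, hm, hmin⟩ := exists_min_compact hb hl
    (isCompact_closedBall c (max R ‖x₀ - c‖)) hx₀ hx hf
  refine ⟨m, hm, fun u hu => ?_⟩
  by_cases hR : R < ‖u - c‖
  · exact (hmin x₀ hx hx₀).trans (h u hu hR)
  · exact hmin u (by simp [dist_eq_norm]; left; linarith) hu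

lemma opt_sub (hb : ∀ x, φ x ≠ ⊥) {ρ : ℝ} (hc : ERealConvex (shiftFun ρ φ))
    {f : EuclideanSpace ℝ (Fin n) → ℝ} {m v : EuclideanSpace ℝ (Fin n)} (hm : φ m ≠ ⊤)
    (hmin : ∀ u, φ u ≠ ⊤ → (φ m).toReal + f m ≤ (φ u).toReal + f u)
    (hf : ∀ u, ∃ K : ℝ, ∀ t : ℝ, 0 < t → t ≤ 1 →
      f (m + t • (u - m)) ≤ f m + t * ⟪v, u - m⟫ + K * t ^ 2) :
    (m, -v) ∈ gphSubdiff ρ φ := by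
  rw [mem_gph hb]
  refine ⟨hm, fun u hu => ?_⟩
  obtain ⟨K, hK⟩ := hf u
  set r := ‖u - m‖ with hr
  set G := (φ u).toReal - (φ m).toReal + ⟪v, u - m⟫ + ρ / 2 * r ^ 2 with hG
  have key : ∀ t : ℝ, 0 < t → t ≤ 1 → 0 ≤ G + t * (K - ρ / 2 * r ^ 2) := by
    intro t ht ht1
    obtain ⟨h1, h2⟩ := weak_conv hb hc hm hu (a := 1 - t) (b := t) (by linarith) ht.le (by ring)
    have e : (1 - t) • m + t • u = m + t • (u - m) := by module
    rw [e] at h1 h2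
    have h3 := hmin _ h1
    have h4 := hK t ht ht1
    rw [norm_sub_rev m u, ← hr] at h2
    have : 0 ≤ t * (G + t * (K - ρ / 2 * r ^ 2)) := by
      rw [hG]; nlinarith
    exact nonneg_of_mul_nonneg_right this ht
  have hG0 : 0 ≤ G := by
    have ht : Tendsto (fun t : ℝ => G + t * (K - ρ / 2 * r ^ 2)) (𝓝[>] 0) (𝓝 G) := by
      have : Continuous (fun t : ℝ => G + t * (K - ρ / 2 * r ^ 2)) := by fun_prop
      have := this.tendsto 0
      simp only [zero_mul, add_zero] at this
      exact this.mono_left nhdsWithin_le_nhds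
    refine ge_of_tendsto ht ?_
    filter_upwards [Ioc_mem_nhdsGT (show (0:ℝ) < 1 by norm_num)] with t ht
    exact key t ht.1 ht.2
  rw [inner_neg_left]
  linarith

lemma prox_exists (hb : ∀ x, φ x ≠ ⊥) (hl : LowerSemicontinuous φ) {ρ : ℝ}
    (hc : ERealConvex (shiftFun ρ φ)) {p q : EuclideanSpace ℝ (Fin n)} {A : ℝ} (hp : φ p ≠ ⊤)
    (haff : ∀ u, φ u ≠ ⊤ → A + ⟪q, u - p⟫ ≤ (φ u).toReal) {lam : ℝ} (hlam : 0 < lam)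
    (s : EuclideanSpace ℝ (Fin n)) :
    ∃ m, (m, lam⁻¹ • (s - m)) ∈ gphSubdiff ρ φ := by
  have hf : Continuous (fun u : EuclideanSpace ℝ (Fin n) => ‖u - s‖ ^ 2 / (2 * lam)) := by fun_prop
  set M := (φ p).toReal + ‖p - s‖ ^ 2 / (2 * lam) with hM
  set K := |M - A + ‖q‖ * ‖s - p‖| with hK
  obtain ⟨m, hm, hmin⟩ := exists_min_s12 hb hl hp hf s (2 * lam * (‖q‖ + K) + 1) (by
    intro u hu hR
    have h1 := haff u hu
    have h2 : -(‖q‖ * (‖u - s‖ + ‖s - p‖)) ≤ ⟪q, u - p⟫ := by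
      have := abs_real_inner_le_norm q (u - p)
      have h3 : ‖u - p‖ ≤ ‖u - s‖ + ‖s - p‖ := norm_sub_le_norm_sub_add_norm_sub ..
      have := mul_le_mul_of_nonneg_left h3 (norm_nonneg q)
      have := neg_abs_le ⟪q, u - p⟫
      linarith
    have hK0 : 0 ≤ K := abs_nonneg _
    have hKle := le_abs_self (M - A + ‖q‖ * ‖s - p‖)
    rw [← hK] at hKle
    set t := ‖u - s‖
    have ht1 : 1 ≤ t := by
      have : 0 ≤ 2 * lam * (‖q‖ + K) := by positivity
      linarith
    have h4 : t * (‖q‖ + K) ≤ t ^ 2 / (2 * lam) := by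
      rw [le_div_iff₀ (by positivity)]
      nlinarith
    have : K ≤ t * K := le_mul_of_one_le_left hK0 ht1
    show M ≤ _
    nlinarith)
  refine ⟨m, ?_⟩
  have := opt_sub hb hc (f := fun u => ‖u - s‖ ^ 2 / (2 * lam)) (v := lam⁻¹ • (m - s)) hm hmin (by
    intro u
    refine ⟨‖u - m‖ ^ 2 / (2 * lam), fun t ht ht1 => le_of_eq ?_⟩
    have e : m + t • (u - m) - s = (m - s) + t • (u - m) := by module
    rw [e, norm_add_sq_real, real_inner_smul_left, real_inner_smul_right, norm_smul, mul_pow,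
      Real.norm_eq_abs, sq_abs]
    field_simp)
  convert this using 2
  rw [← smul_neg, neg_sub]

lemma weak_mono (hb : ∀ x, φ x ≠ ⊥) {ρ : ℝ} {p q p' q' : EuclideanSpace ℝ (Fin n)}
    (h : (p, q) ∈ gphSubdiff ρ φ) (h' : (p', q') ∈ gphSubdiff ρ φ) :
    -(ρ * ‖p - p'‖ ^ 2) ≤ ⟪p - p', q - q'⟫ := by
  rw [mem_gph hb] at h h'
  have h1 := h.2 p' h'.1
  have h2 := h'.2 p h.1
  rw [norm_sub_rev p' p] at h1
  have e : ⟪q, p' - p⟫ + ⟪q', p - p'⟫ = - ⟪p - p', q - q'⟫ := by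
    rw [← neg_sub p p', inner_neg_right, inner_sub_right (p - p'), real_inner_comm q, real_inner_comm q']
    ring
  linarith

lemma forward (hb : ∀ x, φ x ≠ ⊥) (hl : LowerSemicontinuous φ)
    (hc : ERealConvex (shiftFun 0 φ)) {x y w z : EuclideanSpace ℝ (Fin n)}
    (hxy : (x, y) ∈ gphSubdiff 0 φ) (hn : (z, -w) ∈ regNormalCone (gphSubdiff 0 φ) (x, y)) :
    0 ≤ ⟪z, w⟫ := by
  have step : ∀ lam : ℝ, 0 < lam → 0 ≤ ⟪w, lam • z + w⟫ := by
    intro lam hlam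
    set d := lam • z + w with hd
    have key : ∀ ε : ℝ, 0 < ε → -⟪w, d⟫ ≤ ε * (lam * (‖d‖ * (1 + lam⁻¹))) := by
      intro ε hε
      obtain ⟨δ, hδ, hδ'⟩ := hn ε hε
      set B := ‖d‖ * (1 + lam⁻¹) with hB
      have hB0 : 0 ≤ B := by positivity
      obtain ⟨t, ht, htB⟩ : ∃ t : ℝ, 0 < t ∧ t * B < δ := by
        refine ⟨δ / (B + 1), by positivity, ?_⟩
        rw [div_mul_eq_mul_div, div_lt_iff₀ (by positivity)]
        nlinarith
      have hxy' := (mem_gph hb).1 hxy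
      obtain ⟨m, hm⟩ := prox_exists hb hl hc hxy'.1 (p := x) (q := y) (A := (φ x).toReal) (by
        intro u hu
        have := hxy'.2 u hu
        linarith) hlam (x + lam • y + t • d)
      set q := lam⁻¹ • (x + lam • y + t • d - m) with hq
      have hmono := weak_mono hb hm hxy
      set h := m - x with hh
      set k := q - y with hk
      have hsum : h + lam • k = t • d := by
        rw [hh, hk, hq, smul_sub, smul_smul, mul_inv_cancel₀ hlam.ne']
        module
      have hmono' : 0 ≤ ⟪h, k⟫ := by linarith
      have hnsq : t ^ 2 * ‖d‖ ^ 2 = ‖h‖ ^ 2 + lam ^ 2 * ‖k‖ ^ 2 + 2 * (lam * ⟪h, k⟫) := by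
        have : ‖h + lam • k‖ ^ 2 = ‖t • d‖ ^ 2 := by rw [hsum]
        rw [norm_add_sq_real, norm_smul, norm_smul, mul_pow, mul_pow, Real.norm_eq_abs,
          Real.norm_eq_abs, sq_abs, sq_abs, real_inner_smul_right] at this
        linarith
      have hlk : 0 ≤ lam * ⟪h, k⟫ := by positivity
      have hh1 : ‖h‖ ≤ t * ‖d‖ := by
        apply le_of_sq_le_sq _ (by positivity)
        have : 0 ≤ lam ^ 2 * ‖k‖ ^ 2 := by positivity
        nlinarith
      have hk1 : ‖k‖ ≤ t * ‖d‖ * lam⁻¹ := by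
        rw [← div_eq_mul_inv, le_div_iff₀ hlam]
        apply le_of_sq_le_sq _ (by positivity)
        have : 0 ≤ ‖h‖ ^ 2 := by positivity
        nlinarith
      have hnorm : ‖((m, q) : EuclideanSpace ℝ (Fin n) × EuclideanSpace ℝ (Fin n)) - (x, y)‖
          ≤ t * B := by
        rw [Prod.mk_sub_mk, Prod.norm_mk, hB]
        have h0 : 0 ≤ t * ‖d‖ := by positivity
        have h1 : 0 ≤ t * ‖d‖ * lam⁻¹ := by positivity
        refine max_le ?_ ?_ <;> nlinarith
      have hp := hδ' (m, q) hm (lt_of_le_of_lt hnorm htB)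
      have hp2 := hp.trans (mul_le_mul_of_nonneg_left hnorm hε.le)
      rw [Prod.mk_sub_mk] at hp2
      simp only [pairInner] at hp2
      rw [← hh, ← hk, inner_neg_left] at hp2
      have e1 : lam * (⟪z, h⟫ - ⟪w, k⟫) = ⟪d, h⟫ - t * ⟪w, d⟫ := by
        have : ⟪w, h⟫ + lam * ⟪w, k⟫ = t * ⟪w, d⟫ := by
          rw [← real_inner_smul_right, ← inner_add_right, hsum, real_inner_smul_right]
        rw [← this]
        rw [hd, inner_add_left, real_inner_smul_left]
        ring
      have e2 : 0 ≤ ⟪d, h⟫ := by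
        have : t * ⟪d, h⟫ = ‖h‖ ^ 2 + lam * ⟪h, k⟫ := by
          rw [← real_inner_smul_left, ← hsum, inner_add_left, real_inner_smul_left,
            real_inner_self_eq_norm_sq, real_inner_comm]
        have h2 : 0 ≤ t * ⟪d, h⟫ := by rw [this]; positivity
        exact nonneg_of_mul_nonneg_right h2 ht
      have e3 := mul_le_mul_of_nonneg_left hp2 hlam.le
      have : t * (-⟪w, d⟫) ≤ t * (ε * (lam * B)) := by nlinarith
      exact le_of_mul_le_mul_left this ht
    by_contra hneg
    push Not at hneg
    set B := lam * (‖d‖ * (1 + lam⁻¹))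
    have hB0 : 0 ≤ B := by positivity
    have := key (-⟪w, d⟫ / (2 * (B + 1))) (div_pos (by linarith) (by positivity))
    rw [div_mul_eq_mul_div, le_div_iff₀ (by positivity)] at this
    nlinarith
  by_contra hneg
  push Not at hneg
  have := step ((‖w‖ ^ 2 + 1) / (-⟪z, w⟫)) (div_pos (by positivity) (by linarith))
  rw [inner_add_right, real_inner_smul_right, real_inner_self_eq_norm_sq, real_inner_comm z w] at this
  have e : (‖w‖ ^ 2 + 1) / (-⟪z, w⟫) * ⟪z, w⟫ = -(‖w‖ ^ 2 + 1) := by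
    field_simp [hneg.ne]
  linarith

lemma gph_closed (hl : LowerSemicontinuous φ) (hprop : ∃ x, φ x ≠ ⊤) (ρ : ℝ) :
    IsClosed (gphSubdiff ρ φ) := by
  have e : gphSubdiff ρ φ = ⋂ u, {p : EuclideanSpace ℝ (Fin n) × EuclideanSpace ℝ (Fin n) |
      φ p.1 + ((⟪p.2, u - p.1⟫ - (ρ / 2) * ‖u - p.1‖ ^ 2 : ℝ) : EReal) ≤ φ u} := by
    ext p
    simp only [gphSubdiff, subdiff, mem_ofPred_eq, mem_iInter, and_iff_right_iff_imp]
    intro h ht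
    obtain ⟨x₀, hx₀⟩ := hprop
    have := h x₀
    rw [ht, EReal.top_add_coe] at this
    exact hx₀ (top_le_iff.1 this)
  rw [e]
  refine isClosed_iInter fun u => ?_
  have h1 : LowerSemicontinuous (fun p : EuclideanSpace ℝ (Fin n) × EuclideanSpace ℝ (Fin n) =>
      φ p.1 + ((⟪p.2, u - p.1⟫ - (ρ / 2) * ‖u - p.1‖ ^ 2 : ℝ) : EReal)) :=
    lsc_add_cont (hl.comp continuous_fst) (by fun_prop)
  exact h1.isClosed_preimage (φ u)

set_option maxHeartbeats 2000000 in
lemma mono_of_cond (hb : ∀ x, φ x ≠ ⊥) (hl : LowerSemicontinuous φ) (hprop : ∃ x, φ x ≠ ⊤)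
    {ρ : ℝ} (hρ : 0 ≤ ρ)
    (hcond : ∀ x y : EuclideanSpace ℝ (Fin n), (x, y) ∈ gphSubdiff ρ φ →
          ∀ w z : EuclideanSpace ℝ (Fin n),
            (z, -w) ∈ regNormalCone (gphSubdiff ρ φ) (x, y) → 0 ≤ ⟪z, w⟫)
    {pb qb pa qa : EuclideanSpace ℝ (Fin n)} (hB : (pb, qb) ∈ gphSubdiff ρ φ)
    (hA : (pa, qa) ∈ gphSubdiff ρ φ) : 0 ≤ ⟪pa - pb, qa - qb⟫ := by
  set lam : ℝ := 1 / (2 * (ρ + 1)) with hlam_def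
  have hlam : 0 < lam := by positivity
  have hlr : lam * ρ ≤ 1 / 2 := by
    rw [hlam_def, div_mul_eq_mul_div, div_le_div_iff₀ (by positivity) (by norm_num)]
    linarith
  -- bounds
  have bound : ∀ p q, (p, q) ∈ gphSubdiff ρ φ →
      ‖p - pb‖ ≤ 2 * ‖(p - pb) + lam • (q - qb)‖ ∧
      lam * ‖q - qb‖ ≤ 3 * ‖(p - pb) + lam • (q - qb)‖ := by
    intro p q h
    have hm := weak_mono hb h hB
    set h := p - pb
    set k := q - qb
    set σ := h + lam • k with hσ
    have h1 : ⟪h, σ⟫ = ‖h‖ ^ 2 + lam * ⟪h, k⟫ := by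
      rw [hσ, inner_add_right, real_inner_smul_right, real_inner_self_eq_norm_sq]
    have h2 := real_inner_le_norm h σ
    have h3 : ‖h‖ * ‖h‖ ≤ ‖h‖ * (2 * ‖σ‖) := by
      have := mul_le_mul_of_nonneg_left hm hlam.le
      have h5 := mul_le_mul_of_nonneg_right hlr (sq_nonneg ‖h‖)
      nlinarith
    have h4 : ‖h‖ ≤ 2 * ‖σ‖ := by
      rcases (norm_nonneg h).eq_or_lt with h0 | h0
      · rw [← h0]; positivity
      · exact le_of_mul_le_mul_left h3 h0
    refine ⟨h4, ?_⟩
    have h6 : lam • k = σ - h := by rw [hσ]; module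
    have h7 : ‖lam • k‖ = lam * ‖k‖ := by rw [norm_smul, Real.norm_of_nonneg hlam.le]
    rw [← h7, h6]
    have := norm_sub_le σ h
    linarith
  have key : ∀ (d : EuclideanSpace ℝ (Fin n)) (c κ : ℝ), ‖d‖ < c → 0 < κ →
      0 ≤ ⟪d, (pa - pb) - lam • (qa - qb)⟫ + c * ‖(pa - pb) + lam • (qa - qb)‖
        + c * κ * ‖(pa - pb) + lam • (qa - qb)‖ ^ 2 := by
    intro d c κ hdc hκ
    have hc : 0 < c := lt_of_le_of_lt (norm_nonneg d) hdc
    set Θ : EuclideanSpace ℝ (Fin n) × EuclideanSpace ℝ (Fin n) → ℝ := fun u =>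
      ⟪d, (u.1 - pb) - lam • (u.2 - qb)⟫ + c * ‖(u.1 - pb) + lam • (u.2 - qb)‖
        + c * κ * ‖(u.1 - pb) + lam • (u.2 - qb)‖ ^ 2 with hΘ
    have hΘc : Continuous Θ := by fun_prop
    have hΘb : Θ (pb, qb) = 0 := by simp [hΘ]
    set R := 5 * ‖d‖ / (c * κ) with hR
    have hR0 : 0 ≤ R := by positivity
    have hfar : ∀ u ∈ gphSubdiff ρ φ, R < ‖(u.1 - pb) + lam • (u.2 - qb)‖ → 0 ≤ Θ u := by
      rintro ⟨p, q⟩ hu hlt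
      obtain ⟨b1, b2⟩ := bound p q hu
      simp only [hΘ] at hlt ⊢
      set σ := (p - pb) + lam • (q - qb) with hσ
      have h1 : ‖(p - pb) - lam • (q - qb)‖ ≤ 5 * ‖σ‖ := by
        have := norm_sub_le (p - pb) (lam • (q - qb))
        rw [norm_smul, Real.norm_of_nonneg hlam.le] at this
        linarith
      have h2 := neg_abs_le ⟪d, (p - pb) - lam • (q - qb)⟫
      have h3 := abs_real_inner_le_norm d ((p - pb) - lam • (q - qb))
      have h4 := mul_le_mul_of_nonneg_left h1 (norm_nonneg d)
      rw [hR, div_lt_iff₀ (by positivity)] at hlt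
      have h5 := mul_le_mul_of_nonneg_right hlt.le (norm_nonneg σ)
      have h6 : 0 ≤ c * ‖σ‖ := by positivity
      nlinarith
    set R' := 2 * R + 3 * R / lam with hR'
    have hR'1 : 2 * R ≤ R' := by
      have : 0 ≤ 3 * R / lam := by positivity
      linarith
    have hR'2 : 3 * R / lam ≤ R' := by linarith
    have hKc : IsCompact (gphSubdiff ρ φ ∩ Metric.closedBall (pb, qb) R') :=
      (isCompact_closedBall _ _).inter_left (gph_closed hl hprop ρ)
    have hbK : (pb, qb) ∈ gphSubdiff ρ φ ∩ Metric.closedBall (pb, qb) R' :=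
      ⟨hB, Metric.mem_closedBall_self (by linarith)⟩
    obtain ⟨⟨p₀, q₀⟩, ⟨hS0, -⟩, hmin⟩ := hKc.exists_isMinOn ⟨_, hbK⟩ hΘc.continuousOn
    have hmin0 : Θ (p₀, q₀) ≤ 0 := by
      rw [← hΘb]; exact hmin hbK
    have hglob : ∀ u ∈ gphSubdiff ρ φ, Θ (p₀, q₀) ≤ Θ u := by
      rintro ⟨p, q⟩ hu
      by_cases hlt : R < ‖(p - pb) + lam • (q - qb)‖
      · exact hmin0.trans (hfar (p, q) hu hlt)
      · apply hmin
        refine ⟨hu, ?_⟩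
        obtain ⟨b1, b2⟩ := bound p q hu
        push Not at hlt
        rw [Metric.mem_closedBall, dist_eq_norm, Prod.mk_sub_mk, Prod.norm_mk]
        refine max_le (by linarith) (le_trans ?_ hR'2)
        rw [le_div_iff₀ hlam]
        linarith
    set σ₀ := (p₀ - pb) + lam • (q₀ - qb) with hσ₀
    by_cases hz : σ₀ = 0
    · obtain ⟨b1, b2⟩ := bound p₀ q₀ hS0
      rw [← hσ₀, hz, norm_zero, mul_zero] at b1 b2
      have e1 : p₀ = pb := by
        rw [← sub_eq_zero, ← norm_eq_zero]; exact le_antisymm b1 (norm_nonneg _)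
      have e2 : q₀ = qb := by
        rw [← sub_eq_zero, ← norm_eq_zero]
        exact le_antisymm (by nlinarith) (norm_nonneg _)
      have := hglob _ hA
      rw [e1, e2, hΘb] at this
      exact this
    · exfalso
      set N := ‖σ₀‖ with hN
      have hN0 : 0 < N := norm_pos_iff.2 hz
      set v := (c * (1 / N + 2 * κ)) • σ₀ with hv
      set C := c * (1 / (2 * N) + κ) with hC
      have hC0 : 0 ≤ C := by positivity
      have hnorm : (-(d + v), -(lam • (v - d))) ∈ regNormalCone (gphSubdiff ρ φ) (p₀, q₀) := by
        intro ε hε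
        refine ⟨ε / (C * (1 + lam) ^ 2 + 1), by positivity, ?_⟩
        rintro ⟨p, q⟩ hu hlt
        have h1 := hglob _ hu
        simp only [hΘ] at h1
        rw [Prod.mk_sub_mk] at hlt ⊢
        simp only [pairInner]
        set h := p - p₀ with hh
        set k := q - q₀ with hk
        set σ' := h + lam • k with hσ'
        have eσ : (p - pb) + lam • (q - qb) = σ₀ + σ' := by
          rw [hσ', hσ₀, hh, hk]; module
        have eF : (p - pb) - lam • (q - qb) = ((p₀ - pb) - lam • (q₀ - qb)) + (h - lam • k) := by
          rw [hh, hk]; module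
        rw [eσ, eF, ← hσ₀, ← hN, inner_add_right] at h1
        have hsq : ‖σ₀ + σ'‖ ^ 2 = N ^ 2 + 2 * ⟪σ₀, σ'⟫ + ‖σ'‖ ^ 2 := norm_add_sq_real _ _
        have hn1 : ‖σ₀ + σ'‖ ≤ N + ⟪σ₀, σ'⟫ / N + ‖σ'‖ ^ 2 / (2 * N) := by
          have e : N + ⟪σ₀, σ'⟫ / N + ‖σ'‖ ^ 2 / (2 * N) = (‖σ₀ + σ'‖ ^ 2 + N ^ 2) / (2 * N) := by
            rw [hsq]; field_simp; ring
          rw [e, le_div_iff₀ (by positivity)]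
          nlinarith [sq_nonneg (‖σ₀ + σ'‖ - N)]
        rw [hsq] at h1
        have h2 := mul_le_mul_of_nonneg_left hn1 hc.le
        have ev : ⟪v, σ'⟫ = c * (⟪σ₀, σ'⟫ / N) + c * κ * (2 * ⟪σ₀, σ'⟫) := by
          rw [hv, real_inner_smul_left]; ring
        have h3 : -(⟪d, h - lam • k⟫ + ⟪v, σ'⟫) ≤ C * ‖σ'‖ ^ 2 := by
          have : C * ‖σ'‖ ^ 2 = c * (‖σ'‖ ^ 2 / (2 * N)) + c * κ * ‖σ'‖ ^ 2 := by rw [hC]; ring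
          rw [ev, this]
          linarith
        have h4 : ⟪-(d + v), h⟫ + ⟪-(lam • (v - d)), k⟫ = -(⟪d, h - lam • k⟫ + ⟪v, σ'⟫) := by
          rw [hσ']
          simp only [inner_add_left, inner_add_right, inner_neg_left, real_inner_smul_left,
            inner_sub_left, inner_sub_right, real_inner_smul_right]
          ring
        rw [h4]
        refine h3.trans ?_
        set r := ‖((h, k) : EuclideanSpace ℝ (Fin n) × EuclideanSpace ℝ (Fin n))‖ with hr
        have hr1 : ‖h‖ ≤ r := norm_fst_le (h, k)
        have hr2 : ‖k‖ ≤ r := norm_snd_le (h, k)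
        have hr0 : 0 ≤ r := norm_nonneg _
        have h5 : ‖σ'‖ ≤ (1 + lam) * r := by
          have := norm_add_le h (lam • k)
          rw [norm_smul, Real.norm_of_nonneg hlam.le] at this
          have := mul_le_mul_of_nonneg_left hr2 hlam.le
          linarith
        have h6 : ‖σ'‖ ^ 2 ≤ ((1 + lam) * r) ^ 2 := by gcongr
        rw [lt_div_iff₀ (by positivity)] at hlt
        have h7 := mul_le_mul_of_nonneg_left h6 hC0
        have h8 := mul_le_mul_of_nonneg_right hlt.le hr0
        nlinarith
      have h0 := hcond _ _ hS0 _ _ hnorm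
      have e0 : ⟪-(d + v), lam • (v - d)⟫ = lam * (‖d‖ ^ 2 - ‖v‖ ^ 2) := by
        simp only [inner_add_left, inner_neg_left, inner_sub_right, real_inner_smul_right,
          real_inner_self_eq_norm_sq]
        rw [real_inner_comm d v]; ring
      rw [e0] at h0
      have hvn : ‖v‖ = c * (1 + 2 * κ * N) := by
        rw [hv, norm_smul, Real.norm_of_nonneg (by positivity), ← hN]
        field_simp
      have hvc : c ≤ ‖v‖ := by
        rw [hvn]
        have : 0 ≤ c * (2 * κ * N) := by positivity
        linarith
      have h1 : ‖d‖ ^ 2 < ‖v‖ ^ 2 := by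
        have := norm_nonneg d
        gcongr; linarith
      nlinarith
  set h := pa - pb
  set k := qa - qb
  set F := h - lam • k with hF
  set σ := h + lam • k with hσ
  have hfin : ‖F‖ ≤ ‖σ‖ := by
    by_contra hlt
    push Not at hlt
    have h1 : ∀ t : ℝ, 0 < t → ‖F‖ ^ 2 ≤ (‖F‖ + t) * ‖σ‖ + (‖F‖ + t) * t * ‖σ‖ ^ 2 := by
      intro t ht
      have := key (-F) (‖F‖ + t) t (by rw [norm_neg]; linarith) ht
      rw [inner_neg_left, real_inner_self_eq_norm_sq] at this
      linarith
    have h2 : ‖F‖ ^ 2 ≤ ‖F‖ * ‖σ‖ := by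
      have ht : Tendsto (fun t : ℝ => (‖F‖ + t) * ‖σ‖ + (‖F‖ + t) * t * ‖σ‖ ^ 2) (𝓝[>] 0)
          (𝓝 (‖F‖ * ‖σ‖)) := by
        have hcn : Continuous (fun t : ℝ => (‖F‖ + t) * ‖σ‖ + (‖F‖ + t) * t * ‖σ‖ ^ 2) := by
          fun_prop
        have := hcn.tendsto 0
        simp only [mul_zero, add_zero, zero_mul] at this
        exact this.mono_left nhdsWithin_le_nhds
      refine ge_of_tendsto ht ?_
      filter_upwards [self_mem_nhdsWithin] with t ht
      exact h1 t ht
    have := norm_nonneg σ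
    nlinarith
  have e : 4 * (lam * ⟪h, k⟫) = ‖σ‖ ^ 2 - ‖F‖ ^ 2 := by
    rw [hσ, hF, norm_add_sq_real h, norm_sub_sq_real h (lam • k), real_inner_smul_right]; ring
  have : 0 ≤ lam * ⟪h, k⟫ := by
    have : ‖F‖ ^ 2 ≤ ‖σ‖ ^ 2 := by gcongr
    linarith
  exact nonneg_of_mul_nonneg_right this hlam

lemma conv_sub (hb : ∀ x, φ x ≠ ⊥) (hl : LowerSemicontinuous φ)
    {ρ : ℝ} (hρ : 0 ≤ ρ) (hc : ERealConvex (shiftFun ρ φ))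
    (hmono : ∀ p q p' q' : EuclideanSpace ℝ (Fin n), (p, q) ∈ gphSubdiff ρ φ →
      (p', q') ∈ gphSubdiff ρ φ → 0 ≤ ⟪p' - p, q' - q⟫)
    {p q : EuclideanSpace ℝ (Fin n)} (hpq : (p, q) ∈ gphSubdiff ρ φ)
    {u : EuclideanSpace ℝ (Fin n)} (hu : φ u ≠ ⊤) :
    (φ p).toReal + ⟪q, u - p⟫ ≤ (φ u).toReal := by
  have hpq' := (mem_gph hb).1 hpq
  have key : ∀ η : ℝ, 0 < η → (φ p).toReal + ⟪q, u - p⟫ ≤ (φ u).toReal + η * ‖u - p‖ ^ 4 := by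
    intro η hη
    obtain ⟨m, hm, hmin⟩ := exists_min_s12 hb hl hpq'.1
      (f := fun u => η * (‖u - p‖ ^ 2) ^ 2 - ⟪q, u - p⟫) (by fun_prop) p (ρ / (2 * η) + 1) (by
      intro u hu hR
      have h1 := hpq'.2 u hu
      simp only [sub_self, norm_zero, inner_zero_right]
      set r := ‖u - p‖
      have h0 : 0 ≤ ρ / (2 * η) := by positivity
      have h2 : ρ / (2 * η) ≤ r ^ 2 := by nlinarith
      rw [div_le_iff₀ (by positivity)] at h2
      nlinarith [mul_le_mul_of_nonneg_right h2 (sq_nonneg r)])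
    have hsub := opt_sub hb hc (f := fun u => η * (‖u - p‖ ^ 2) ^ 2 - ⟪q, u - p⟫)
      (v := (4 * η * ‖m - p‖ ^ 2) • (m - p) - q) hm hmin (by
      intro u
      set a := m - p with ha
      set h := u - m with hh
      refine ⟨η * (4 * ⟪a, h⟫ ^ 2 + 2 * ‖a‖ ^ 2 * ‖h‖ ^ 2 + 4 * |⟪a, h⟫| * ‖h‖ ^ 2
        + (‖h‖ ^ 2) ^ 2), fun t ht ht1 => ?_⟩
      have e : m + t • h - p = a + t • h := by rw [ha]; module
      rw [e, norm_add_sq_real, real_inner_smul_right, inner_add_right, real_inner_smul_right,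
        norm_smul, mul_pow, Real.norm_eq_abs, sq_abs, inner_sub_left (_ • a) q, real_inner_smul_left a]
      have hi := le_abs_self ⟪a, h⟫
      set i := ⟪a, h⟫
      set H := ‖h‖ ^ 2 with hH
      have hH0 : 0 ≤ H := by positivity
      have h1 : t * i ≤ |i| := by
        have := abs_nonneg i
        nlinarith
      have h2 : t ^ 2 * H ^ 2 ≤ H ^ 2 := by
        have : t ^ 2 ≤ 1 := by nlinarith
        nlinarith [sq_nonneg H]
      have h3 : t * i * H ≤ |i| * H := mul_le_mul_of_nonneg_right h1 hH0
      have h4 : 0 ≤ η * t ^ 2 * (4 * (|i| * H - t * i * H) + (H ^ 2 - t ^ 2 * H ^ 2)) := by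
        apply mul_nonneg (by positivity); linarith
      nlinarith)
    have h1 := hmono _ _ _ _ hpq hsub
    have e : -((4 * η * ‖m - p‖ ^ 2) • (m - p) - q) - q = -((4 * η * ‖m - p‖ ^ 2) • (m - p)) := by
      module
    rw [e, inner_neg_right, real_inner_smul_right, real_inner_self_eq_norm_sq] at h1
    have h2 : m = p := by
      by_contra hne
      have : 0 < ‖m - p‖ := norm_pos_iff.2 (sub_ne_zero.2 hne)
      have : 0 < 4 * η * ‖m - p‖ ^ 2 * ‖m - p‖ ^ 2 := by positivity
      linarith
    have h3 := hmin u hu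
    rw [h2] at h3
    simp only [sub_self, norm_zero, inner_zero_right] at h3
    nlinarith
  have ht : Tendsto (fun η : ℝ => (φ u).toReal + η * ‖u - p‖ ^ 4) (𝓝[>] 0)
      (𝓝 ((φ u).toReal)) := by
    have hcn : Continuous (fun η : ℝ => (φ u).toReal + η * ‖u - p‖ ^ 4) := by fun_prop
    have := hcn.tendsto 0
    simp only [add_zero, zero_mul] at this
    exact this.mono_left nhdsWithin_le_nhds
  refine ge_of_tendsto ht ?_
  filter_upwards [self_mem_nhdsWithin] with t ht
  exact key t ht

lemma gph_nonempty (hb : ∀ x, φ x ≠ ⊥) (hl : LowerSemicontinuous φ)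
    {ρ : ℝ} (hρ : 0 ≤ ρ) (hc : ERealConvex (shiftFun ρ φ))
    {x₀ : EuclideanSpace ℝ (Fin n)} (hx₀ : φ x₀ ≠ ⊤) :
    ∃ p q, (p, q) ∈ gphSubdiff ρ φ := by
  have hxb : x₀ ∈ Metric.closedBall x₀ 1 := Metric.mem_closedBall_self (by norm_num)
  obtain ⟨m₀, hm₀b, hm₀, hmin₀⟩ := exists_min_compact hb hl
    (isCompact_closedBall x₀ 1) hx₀ hxb (f := fun _ => 0) continuous_const
  simp only [add_zero] at hmin₀
  have hΔ := hmin₀ x₀ hxb hx₀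
  set C := (φ x₀).toReal - (φ m₀).toReal + ρ / 2 with hC
  obtain ⟨m, hm, hmin⟩ := exists_min_s12 hb hl hx₀
    (f := fun u => C * ‖u - x₀‖ ^ 2) (by fun_prop) x₀ 1 (by
      intro u hu hR
      simp only [sub_self, norm_zero]
      set r := ‖u - x₀‖ with hr
      have hr0 : 0 < r := by linarith
      have hri : 0 < r⁻¹ := by positivity
      have hri1 : r⁻¹ ≤ 1 := inv_le_one_of_one_le₀ hR.le
      obtain ⟨h1, h2⟩ := weak_conv hb hc hx₀ hu (a := 1 - r⁻¹) (b := r⁻¹) (by linarith) hri.le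
        (by ring)
      have h3 := hmin₀ _ (by
        rw [Metric.mem_closedBall, dist_eq_norm]
        have e : (1 - r⁻¹) • x₀ + r⁻¹ • u - x₀ = r⁻¹ • (u - x₀) := by module
        rw [e, norm_smul, Real.norm_of_nonneg hri.le, ← hr, inv_mul_cancel₀ hr0.ne']) h1
      rw [norm_sub_rev x₀ u, ← hr] at h2
      have h4 := mul_le_mul_of_nonneg_left (h3.trans h2) hr0.le
      have e : r * ((1 - r⁻¹) * (φ x₀).toReal + r⁻¹ * (φ u).toReal
          + ρ / 2 * ((1 - r⁻¹) * r⁻¹ * r ^ 2))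
          = (r - 1) * (φ x₀).toReal + (φ u).toReal + ρ / 2 * ((r - 1) * r) := by
        field_simp
      rw [e] at h4
      have h5 : 0 ≤ ((φ x₀).toReal - (φ m₀).toReal) * (r ^ 2 - r) :=
        mul_nonneg (by linarith) (by nlinarith)
      have h6 : 0 ≤ ρ * r := by positivity
      rw [hC]
      nlinarith)
  refine ⟨m, _, opt_sub hb hc (f := fun u => C * ‖u - x₀‖ ^ 2) (v := (2 * C) • (m - x₀))
    hm hmin ?_⟩
  intro u
  refine ⟨C * ‖u - m‖ ^ 2, fun t ht ht1 => le_of_eq ?_⟩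
  have e : m + t • (u - m) - x₀ = (m - x₀) + t • (u - m) := by module
  rw [e, norm_add_sq_real, real_inner_smul_left, real_inner_smul_right, norm_smul, mul_pow,
    Real.norm_eq_abs, sq_abs]
  ring

lemma backward (hb : ∀ x, φ x ≠ ⊥) (hl : LowerSemicontinuous φ) (hprop : ∃ x, φ x ≠ ⊤)
    {ρ : ℝ} (hρ : 0 ≤ ρ) (hc : ERealConvex (shiftFun ρ φ))
    (hcond : ∀ x y : EuclideanSpace ℝ (Fin n), (x, y) ∈ gphSubdiff ρ φ →
          ∀ w z : EuclideanSpace ℝ (Fin n),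
            (z, -w) ∈ regNormalCone (gphSubdiff ρ φ) (x, y) → 0 ≤ ⟪z, w⟫) :
    ERealConvex φ := by
  have hmono : ∀ p q p' q' : EuclideanSpace ℝ (Fin n), (p, q) ∈ gphSubdiff ρ φ →
      (p', q') ∈ gphSubdiff ρ φ → 0 ≤ ⟪p' - p, q' - q⟫ :=
    fun p q p' q' h h' => mono_of_cond hb hl hprop hρ hcond h h'
  intro x y a b ha hb' hab
  rcases ha.eq_or_lt with rfl | ha0
  · obtain rfl : b = 1 := by linarith
    simp
  rcases hb'.eq_or_lt with rfl | hb0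
  · obtain rfl : a = 1 := by linarith
    simp
  have hmulbot : ∀ (c : ℝ) (z : EuclideanSpace ℝ (Fin n)), 0 < c → (c : EReal) * φ z ≠ ⊥ := by
    intro c z hc0
    by_cases hz : φ z = ⊤
    · rw [hz, EReal.coe_mul_top_of_pos hc0]; simp
    · rw [coe_toR hb hz]; norm_cast; exact EReal.coe_ne_bot _
  by_cases hx : φ x = ⊤
  · rw [hx, EReal.coe_mul_top_of_pos ha0, EReal.top_add_of_ne_bot (hmulbot b y hb0)]
    exact le_top
  by_cases hy : φ y = ⊤
  · rw [hy, EReal.coe_mul_top_of_pos hb0, EReal.add_top_of_ne_bot (hmulbot a x ha0)]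
    exact le_top
  set M := a * (φ x).toReal + b * (φ y).toReal with hM
  have hrhs : (a : EReal) * φ x + (b : EReal) * φ y = ((M : ℝ) : EReal) := by
    rw [coe_toR hb hx, coe_toR hb hy, hM]; norm_cast
  rw [hrhs]
  obtain ⟨p₀, q₀, h₀⟩ := gph_nonempty hb hl hρ hc hx
  have h₀' := (mem_gph hb).1 h₀
  have haff := fun u (hu : φ u ≠ ⊤) => conv_sub hb hl hρ hc hmono h₀ hu
  set s := a • x + b • y with hs
  have hcl : IsClosed {u | φ u ≤ ((M : ℝ) : EReal)} := hl.isClosed_preimage _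
  suffices s ∈ closure {u | φ u ≤ ((M : ℝ) : EReal)} by
    rw [hcl.closure_eq] at this; exact this
  rw [Metric.mem_closure_iff]
  intro ε hε
  set A := (φ p₀).toReal + ⟪q₀, s - p₀⟫ with hA
  set L := |M - A| / ε ^ 2 + ‖q₀‖ / ε + 1 with hL
  have hL0 : 0 < L := by positivity
  obtain ⟨m, hm⟩ := prox_exists hb hl hc h₀'.1 haff (inv_pos.2 hL0) s
  rw [inv_inv] at hm
  have hm' := (mem_gph hb).1 hm
  have hX := conv_sub hb hl hρ hc hmono hm hx
  have hY := conv_sub hb hl hρ hc hmono hm hy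
  have hbb : b = 1 - a := by linarith
  have hsum : (φ m).toReal + L * ‖s - m‖ ^ 2 ≤ M := by
    have e : a * ⟪L • (s - m), x - m⟫ + b * ⟪L • (s - m), y - m⟫ = L * ‖s - m‖ ^ 2 := by
      rw [← real_inner_smul_right, ← real_inner_smul_right, ← inner_add_right]
      have : a • (x - m) + b • (y - m) = s - m := by
        rw [hs, hbb]; module
      rw [this, real_inner_smul_left, real_inner_self_eq_norm_sq]
    have h1 := mul_le_mul_of_nonneg_left hX ha
    have h2 := mul_le_mul_of_nonneg_left hY hb'
    rw [hM, ← e]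
    have : (φ m).toReal = a * (φ m).toReal + b * (φ m).toReal := by rw [← add_mul, hab, one_mul]
    linarith
  refine ⟨m, ?_, ?_⟩
  · show φ m ≤ _
    rw [coe_toR hb hm'.1]
    have : 0 ≤ L * ‖s - m‖ ^ 2 := by positivity
    exact_mod_cast (by linarith : (φ m).toReal ≤ M)
  · rw [dist_eq_norm]
    by_contra hge
    push Not at hge
    have h1 := haff m hm'.1
    have e : ⟪q₀, m - p₀⟫ = ⟪q₀, s - p₀⟫ - ⟪q₀, s - m⟫ := by
      rw [← inner_sub_right]; congr 1; module
    have h2 := real_inner_le_norm q₀ (s - m)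
    set δ := ‖s - m‖
    have h3 : L * δ ^ 2 ≤ |M - A| + ‖q₀‖ * δ := by
      have := le_abs_self (M - A)
      linarith
    have hδ : 0 < δ := by linarith
    have h4 : |M - A| ≤ |M - A| / ε ^ 2 * δ ^ 2 := by
      rw [div_mul_eq_mul_div, le_div_iff₀ (by positivity)]
      gcongr
    have h5 : ‖q₀‖ * δ ≤ ‖q₀‖ / ε * δ ^ 2 := by
      rw [div_mul_eq_mul_div, le_div_iff₀ (by positivity)]
      have : 0 ≤ ‖q₀‖ * δ := by positivity
      nlinarith
    have h6 : 0 < δ ^ 2 := by positivity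
    rw [hL] at h3
    linarith

/-- convexity characterized via the combined second-order
subdifferential (regular normal cone to the graph of the subdifferential). -/
theorem statement12 (n : ℕ) (φ : EuclideanSpace ℝ (Fin n) → EReal)
    (hnotbot : ∀ x, φ x ≠ ⊥) (hproper : ∃ x, φ x ≠ ⊤)
    (hlsc : LowerSemicontinuous φ) :
    ERealConvex φ ↔
      ∃ ρ : ℝ, 0 ≤ ρ ∧ ERealConvex (shiftFun ρ φ) ∧
        ∀ x y : EuclideanSpace ℝ (Fin n), (x, y) ∈ gphSubdiff ρ φ →
          ∀ w z : EuclideanSpace ℝ (Fin n),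
            (z, -w) ∈ regNormalCone (gphSubdiff ρ φ) (x, y) → 0 ≤ ⟪z, w⟫ := by
  constructor
  · intro h
    have h0 : shiftFun 0 φ = φ := by
      funext x; simp [shiftFun]
    have hc : ERealConvex (shiftFun 0 φ) := by rw [h0]; exact h
    exact ⟨0, le_refl _, hc, fun x y hxy w z hn => forward hnotbot hlsc hc hxy hn⟩
  · rintro ⟨ρ, hρ, hc, hcond⟩
    exact backward hnotbot hlsc hproper hρ hc hcond


end
end
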